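/- Suppose b satisfies Assumption 1 with ρ ∈ (1,2) and Assumption 2, adopt the spectral setup, and let Q be a bounded self-adjoint nonnegative linear operator on H with nonnegative square root Q^{1/2}. Let T > 0, 0 < s ≤ 1/ρ and γ < ρs/2. Then there exists K = K(T,γ,ρ) > 0 such that for every n ≥ 1, with Δt := T/n, t_k := kΔt, and B_m x := ∫₀^∞ S(Δt u)x · e^{−u} u^{m−1}/(m−1)! du for m ≥ 1: Σ_i Σ_{k=1}^n ∫_{t_{k−1}}^{t_k} ‖(S(t_n − u) − B_{n−k+1}) Q^{1/2} e_i‖² du ≤ K Δt^{2γ} Σ_i Σ_j λ_j^{s − 1/ρ} (Q^{1/2} e_i, e_j)². (This is the noise contribution, obtained via Itô's isometry, to the strong error of the Backward Euler–convolution quadrature time discretization of the stochastic Volterra equation.) -/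

import Mathlib

open MeasureTheory Filter Set
open scoped ENNReal NNReal RealInnerProductSpace

noncomputable section

/-- The Laplace transform `b̂(z) = ∫₀^∞ e^{-zt} b(t) dt` of a real-valued kernel `b`. -/
def laplaceTransform (b : ℝ → ℝ) (z : ℂ) : ℂ :=
  ∫ t in Set.Ioi (0 : ℝ), Complex.exp (-z * t) * (b t : ℂ)

/-- Assumption 1: `b` is a nonzero, locally integrable, 3-monotone kernel
(with derivative `b'` on `(0,∞)`), `b(t) → 0` as `t → ∞`, and the angle condition
`ρ = 1 + (2/π) sup{|arg b̂(λ)| : Re λ > 0} ∈ (1,2)` holds. -/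
structure Assumption1 (b b' : ℝ → ℝ) (ρ : ℝ) : Prop where
  locInt : ∀ T > 0, IntegrableOn b (Set.Ioc 0 T)
  ne_zero : ∃ t > 0, b t ≠ 0
  nonneg : ∀ t > 0, 0 ≤ b t
  anti : AntitoneOn b (Set.Ioi 0)
  cvx : ConvexOn ℝ (Set.Ioi 0) b
  hasDeriv : ∀ t > 0, HasDerivAt b (b' t) t
  deriv_nonpos : ∀ t > 0, b' t ≤ 0
  deriv_anti : AntitoneOn (fun t => -(b' t)) (Set.Ioi 0)
  deriv_cvx : ConvexOn ℝ (Set.Ioi 0) (fun t => -(b' t))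
  tendsto_zero : Tendsto b atTop (nhds 0)
  rho_eq : ρ = 1 + (2 / Real.pi) *
      sSup {θ : ℝ | ∃ z : ℂ, 0 < z.re ∧ θ = |(laplaceTransform b z).arg|}
  rho_mem : ρ ∈ Set.Ioo (1 : ℝ) 2

/-- Assumption 2: `b̂` extends analytically to a sector `Σ_θ`, `θ > π/2`, with the
bounds `|b̂^{(k)}(z)| ≤ C |z|^{1-ρ-k}`, `k = 0,1`, there. -/
structure Assumption2 (b : ℝ → ℝ) (ρ θ : ℝ) : Prop where
  theta_gt : Real.pi / 2 < θ
  holo : ∃ B : ℂ → ℂ,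
    (∀ z : ℂ, z ≠ 0 → |z.arg| < θ → DifferentiableAt ℂ B z) ∧
    (∀ z : ℂ, 0 < z.re → B z = laplaceTransform b z) ∧
    ∃ C > 0, (∀ z : ℂ, z ≠ 0 → |z.arg| < θ → ‖B z‖ ≤ C * ‖z‖ ^ (1 - ρ)) ∧
      (∀ z : ℂ, z ≠ 0 → |z.arg| < θ → ‖deriv B z‖ ≤ C * ‖z‖ ^ (-ρ))

/-- `s` (with derivative `s'` on `(0,∞)`) solves the scalar Volterra equation
`s'(t) + λ ∫₀ᵗ b(t-u) s(u) du = 0`, `s(0) = 1`. -/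
structure IsScalarSolution (b : ℝ → ℝ) (lam : ℝ) (s s' : ℝ → ℝ) : Prop where
  init : s 0 = 1
  cont : ContinuousOn s (Set.Ici 0)
  hasDeriv : ∀ t > 0, HasDerivAt s (s' t) t
  eqn : ∀ t > 0, s' t + lam * ∫ u in (0 : ℝ)..t, b (t - u) * s u = 0

/-- The resolvent family `S(t)x = Σ_k s_k(t) (x,e_k) e_k`. -/
def Sop {H : Type*} [NormedAddCommGroup H] [InnerProductSpace ℝ H]
    (e : HilbertBasis ℕ ℝ H) (s : ℕ → ℝ → ℝ) (t : ℝ) (x : H) : H :=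
  ∑' k, (s k t * ⟪x, e k⟫) • (e k : H)

/-- The Backward Euler convolution quadrature operator
`B_k = ∫₀^∞ F(Δt s) e^{-s} s^{k-1}/(k-1)! ds`. -/
def quadB {H : Type*} [NormedAddCommGroup H] [NormedSpace ℝ H]
    (Δt : ℝ) (F : ℝ → H) (k : ℕ) : H :=
  ∫ u in Set.Ioi (0 : ℝ),
    (Real.exp (-u) * u ^ (k - 1) / (Nat.factorial (k - 1) : ℝ)) • F (Δt * u)

/-- The finite element setup: `f` is an orthonormal basis of the finite dimensional
subspace `V_h ⊆ D(A^{1/2})`, consisting of eigenvectors of the discrete operator `A_h`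
(defined via the bilinear form `a(u,v) = Σ_k λ_k (u,e_k)(v,e_k)`) with positive
eigenvalues `μ`. -/
structure FESetup {H : Type*} [NormedAddCommGroup H] [InnerProductSpace ℝ H]
    (e : HilbertBasis ℕ ℝ H) (lam : ℕ → ℝ) (N : ℕ) (f : Fin N → H) (μ : Fin N → ℝ) :
    Prop where
  f_orth : Orthonormal ℝ f
  mu_pos : ∀ j, 0 < μ j
  f_dom : ∀ j, (∑' k, ENNReal.ofReal (lam k * ⟪f j, e k⟫ ^ 2)) < ⊤
  eigen : ∀ j j', (∑' k, lam k * ⟪f j, e k⟫ * ⟪f j', e k⟫) = μ j * ⟪f j, f j'⟫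

/-! ### Complex-analytic estimates in the right half-plane -/

/-- A point of the closed right half-plane and a point of a sector of half-angle less than `π / 2`
cannot cancel. -/
theorem sqrt_mul_add_norm_le_norm_add {z w : ℂ} {κ : ℝ} (hκ₀ : 0 ≤ κ) (hκ : κ < 1) (hz : 0 ≤ z.re)
    (hw : 0 ≤ w.re) (him : |w.im| ≤ κ * ‖w‖) :
    √((1 - κ) / 2) * (‖z‖ + ‖w‖) ≤ ‖z + w‖ := by
  refine le_of_pow_le_pow_left₀ two_ne_zero (norm_nonneg _) ?_
  rw [mul_pow, Real.sq_sqrt (by linarith)]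
  have h1 : ‖z + w‖ ^ 2 = ‖z‖ ^ 2 + ‖w‖ ^ 2 + 2 * (z.re * w.re + z.im * w.im) := by
    simp only [Complex.sq_norm, Complex.normSq_apply, Complex.add_re, Complex.add_im]
    ring
  have h2 : -(z.im * w.im) ≤ ‖z‖ * (κ * ‖w‖) := by
    calc -(z.im * w.im) ≤ |z.im * w.im| := neg_le_abs _
      _ = |z.im| * |w.im| := abs_mul _ _
      _ ≤ _ := mul_le_mul (Complex.abs_im_le_norm z) him (abs_nonneg _) (norm_nonneg _)
  have h3 := mul_nonneg hz hw
  nlinarith [mul_nonneg (by linarith : 0 ≤ 1 + κ) (sq_nonneg (‖z‖ - ‖w‖))]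

/-- Harnack inequality for holomorphic maps from the right half-plane to itself. -/
theorem harnack_lower_bound {P : ℂ → ℂ} (hd : ∀ z : ℂ, 0 < z.re → DifferentiableAt ℂ P z)
    (hre : ∀ z : ℂ, 0 < z.re → 0 ≤ (P z).re) {x₀ p₀ : ℝ} (hx₀ : 0 < x₀) (hp₀ : 0 < p₀)
    (hP : P x₀ = p₀) {z : ℂ} (hz : 0 < z.re) :
    p₀ * (x₀ * z.re / ‖z + x₀‖ ^ 2) ≤ ‖P z‖ := by
  have hPne : ∀ w : ℂ, 0 < w.re → P w + p₀ ≠ 0 := fun w hw h => by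
    have := congrArg Complex.re h
    simp at this
    linarith [hre w hw]
  set φ : ℂ → ℂ := fun ζ => x₀ * ((1 + ζ) / (1 - ζ)) with hφ
  have hne : ∀ ζ : ℂ, ‖ζ‖ < 1 → 1 - ζ ≠ 0 := fun ζ h h0 => by
    rw [← sub_eq_zero.1 h0] at h
    simp at h
  have hφre : ∀ ζ : ℂ, ‖ζ‖ < 1 → 0 < (φ ζ).re := fun ζ h => by
    have hpos : 0 < Complex.normSq (1 - ζ) := Complex.normSq_pos.2 (hne ζ h)
    have h2 : ζ.re * ζ.re + ζ.im * ζ.im < 1 := by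
      rw [← Complex.normSq_apply, ← Complex.sq_norm]
      nlinarith [norm_nonneg ζ]
    simp only [hφ, Complex.re_ofReal_mul, Complex.div_re, ← add_div]
    refine mul_pos hx₀ (div_pos ?_ hpos)
    simp
    nlinarith
  set q : ℂ → ℂ := fun ζ => (P (φ ζ) - p₀) / (P (φ ζ) + p₀) with hq
  have hqd : DifferentiableOn ℂ q (Metric.ball 0 1) := by
    intro ζ hζ
    rw [mem_ball_zero_iff] at hζ
    have hφd : DifferentiableAt ℂ φ ζ := by
      have := hne ζ hζ
      simp only [hφ]
      fun_prop (disch := assumption)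
    have hc : DifferentiableAt ℂ (fun ζ => P (φ ζ)) ζ := (hd _ (hφre ζ hζ)).comp ζ hφd
    exact ((hc.sub_const _).div (hc.add_const _) (hPne _ (hφre ζ hζ))).differentiableWithinAt
  have hqm : MapsTo q (Metric.ball 0 1) (Metric.closedBall 0 1) := by
    intro ζ hζ
    rw [mem_ball_zero_iff] at hζ
    rw [mem_closedBall_zero_iff, hq, norm_div]
    refine div_le_one_of_le₀ ?_ (norm_nonneg _)
    refine le_of_pow_le_pow_left₀ two_ne_zero (norm_nonneg _) ?_
    have := hre _ (hφre ζ hζ)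
    simp only [Complex.sq_norm, Complex.normSq_apply, Complex.add_re, Complex.add_im,
      Complex.sub_re, Complex.sub_im, Complex.ofReal_re, Complex.ofReal_im]
    nlinarith
  have hq0 : q 0 = 0 := by simp [hq, hφ, hP]
  have hzx : z + x₀ ≠ 0 := fun h => by
    have := congrArg Complex.re h
    simp at this
    linarith
  have hN : 0 < ‖z + x₀‖ := norm_pos_iff.2 hzx
  have hsq : ‖z + x₀‖ ^ 2 - ‖z - x₀‖ ^ 2 = 4 * (x₀ * z.re) := by
    simp only [Complex.sq_norm, Complex.normSq_apply, Complex.add_re, Complex.add_im,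
      Complex.sub_re, Complex.sub_im, Complex.ofReal_re, Complex.ofReal_im]
    ring
  have hxz := mul_pos hx₀ hz
  have hlt : ‖z - x₀‖ < ‖z + x₀‖ := by
    apply lt_of_pow_lt_pow_left₀ 2 hN.le
    linarith
  have hζ : ‖(z - x₀) / (z + x₀)‖ < 1 := by
    rw [norm_div]
    exact (div_lt_one hN).2 hlt
  have hx₀' : (x₀ : ℂ) ≠ 0 := by exact_mod_cast hx₀.ne'
  have hφz : φ ((z - x₀) / (z + x₀)) = z := by
    simp only [hφ]
    have h1 : 1 - (z - x₀) / (z + x₀) = 2 * x₀ / (z + x₀) := by field_simp; ring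
    have h2 : 1 + (z - x₀) / (z + x₀) = 2 * z / (z + x₀) := by field_simp; ring
    rw [h1, h2]
    field_simp
  have key := Complex.norm_le_norm_of_mapsTo_ball hqd hqm hq0 hζ
  simp only [hq, hφz, norm_div] at key
  have hD : 0 < ‖P z + p₀‖ := norm_pos_iff.2 (hPne z hz)
  rw [div_le_div_iff₀ hD hN] at key
  have hp : ‖(p₀ : ℂ)‖ = p₀ := by simp [hp₀.le]
  have t1 : p₀ - ‖P z‖ ≤ ‖P z - p₀‖ := by
    have := norm_sub_norm_le (p₀ : ℂ) (P z)
    rwa [hp, norm_sub_rev] at this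
  have t2 : ‖P z + p₀‖ ≤ ‖P z‖ + p₀ := by
    simpa only [hp] using norm_add_le (P z) (p₀ : ℂ)
  rw [← mul_div_assoc, div_le_iff₀ (by positivity)]
  have k2 : (p₀ - ‖P z‖) * ‖z + x₀‖ ≤ ‖z - x₀‖ * (‖P z‖ + p₀) := by
    calc _ ≤ ‖P z - p₀‖ * ‖z + x₀‖ := by gcongr
      _ ≤ _ := key
      _ ≤ _ := by gcongr
  -- `p₀ (N - M) ≤ ‖P z‖ (N + M)` with `M < N`
  have hM := norm_nonneg (z - x₀)
  have k3 : p₀ * (‖z + x₀‖ - ‖z - x₀‖) ≤ ‖P z‖ * (‖z + x₀‖ + ‖z - x₀‖) := by linarith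
  have k4 : p₀ * (4 * (x₀ * z.re)) ≤ ‖P z‖ * (‖z + x₀‖ + ‖z - x₀‖) ^ 2 := by
    rw [← hsq]
    have := mul_le_mul_of_nonneg_right k3 (by linarith : 0 ≤ ‖z + x₀‖ + ‖z - x₀‖)
    linarith
  have k5 : ‖P z‖ * (‖z + x₀‖ + ‖z - x₀‖) ^ 2 ≤ ‖P z‖ * (2 * ‖z + x₀‖) ^ 2 := by
    gcongr
    linarith
  linarith

/-- A holomorphic function on the right half-plane with values in the sector
`|arg| ≤ (ρ - 1) π / 2` and derivative `O(|z| ^ (-ρ))` is bounded below by a multiple of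
`|z| ^ (1 - ρ)` on every half-plane `re z ≥ x₀ > 0`. -/
theorem exists_rpow_le_norm_of_abs_arg_le {B : ℂ → ℂ} {ρ C x₀ p₀ : ℝ} (hρ : ρ ∈ Ioo (1 : ℝ) 2)
    (hC : 0 < C) (hx₀ : 0 < x₀) (hp₀ : 0 < p₀) (hB : B x₀ = p₀)
    (hd : ∀ z : ℂ, 0 < z.re → DifferentiableAt ℂ B z)
    (harg : ∀ z : ℂ, 0 < z.re → |(B z).arg| ≤ (ρ - 1) * (Real.pi / 2))
    (hderiv : ∀ z : ℂ, 0 < z.re → ‖deriv B z‖ ≤ C * ‖z‖ ^ (-ρ)) :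
    ∃ c > 0, ∀ z : ℂ, x₀ ≤ z.re → c * ‖z‖ ^ (1 - ρ) ≤ ‖B z‖ := by
  obtain ⟨hρ1, hρ2⟩ := hρ
  have hpi := Real.pi_pos
  have hre : ∀ z : ℂ, 0 < z.re → 0 ≤ (B z).re := fun z hz =>
    Complex.abs_arg_le_pi_div_two_iff.1 ((harg z hz).trans (by nlinarith))
  have hne : ∀ z : ℂ, 0 < z.re → B z ≠ 0 := fun z hz => by
    have h := harnack_lower_bound hd hre hx₀ hp₀ hB hz
    have hzx : z + x₀ ≠ 0 := fun h => by
      have := congrArg Complex.re h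
      simp at this
      linarith
    have : 0 < p₀ * (x₀ * z.re / ‖z + x₀‖ ^ 2) := by positivity
    exact norm_pos_iff.1 (this.trans_le h)
  set p : ℝ := (ρ - 1)⁻¹ with hp
  have hρ0 : 0 < ρ - 1 := by linarith
  have hppos : 0 < p := inv_pos.2 hρ0
  set P : ℂ → ℂ := fun z => B z ^ (p : ℂ) with hPdef
  have hPd : ∀ z : ℂ, 0 < z.re → DifferentiableAt ℂ P z := fun z hz => by
    refine (hd z hz).cpow_const ?_
    rw [Complex.mem_slitPlane_iff_arg]
    refine ⟨fun h => ?_, hne z hz⟩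
    have := harg z hz
    rw [h, abs_of_pos hpi] at this
    nlinarith
  have hPre : ∀ z : ℂ, 0 < z.re → 0 ≤ (P z).re := fun z hz => by
    have h0 : (P z).re = ‖B z‖ ^ p * Real.cos ((B z).arg * p) := by
      simp only [hPdef]
      rw [Complex.cpow_ofReal_re]
    rw [h0]
    refine mul_nonneg (by positivity) (Real.cos_nonneg_of_mem_Icc (abs_le.1 ?_))
    rw [abs_mul, abs_of_pos hppos]
    calc _ ≤ (ρ - 1) * (Real.pi / 2) * p := by gcongr; exact harg z hz
      _ = _ := by rw [hp]; field_simp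
  have hPx : P x₀ = ((p₀ ^ p : ℝ) : ℂ) := by
    simp only [hPdef]
    rw [hB, Complex.ofReal_cpow hp₀.le]
  have hPnorm : ∀ z : ℂ, 0 < z.re → ‖P z‖ = ‖B z‖ ^ p := fun z hz => by
    simp only [hPdef]
    rw [Complex.norm_cpow_of_ne_zero (hne z hz)]
    simp
  -- choice of the shift
  set c₁ : ℝ := (p₀ ^ p * x₀ / 9) ^ (ρ - 1) with hc₁
  have hc₁pos : 0 < c₁ := by positivity
  obtain ⟨δ, hδ0, hδ1, hδ⟩ : ∃ δ : ℝ, 0 < δ ∧ δ ≤ 1 ∧ 2 * C * δ ≤ c₁ * δ ^ (ρ - 1) := by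
    refine ⟨min 1 ((c₁ / (2 * C)) ^ (2 - ρ)⁻¹), by positivity, min_le_left _ _, ?_⟩
    set δ := min 1 ((c₁ / (2 * C)) ^ (2 - ρ)⁻¹) with hδ
    have hδ0 : 0 < δ := by positivity
    have h1 : δ ^ (2 - ρ) ≤ c₁ / (2 * C) := by
      calc δ ^ (2 - ρ) ≤ ((c₁ / (2 * C)) ^ (2 - ρ)⁻¹) ^ (2 - ρ) :=
            Real.rpow_le_rpow hδ0.le (min_le_right _ _) (by linarith)
        _ = _ := Real.rpow_inv_rpow (by positivity) (by linarith)
    have h2 : δ = δ ^ (2 - ρ) * δ ^ (ρ - 1) := by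
      rw [← Real.rpow_add hδ0]; ring_nf; exact (Real.rpow_one δ).symm
    calc 2 * C * δ = 2 * C * δ ^ (2 - ρ) * δ ^ (ρ - 1) := by rw [mul_assoc _ (δ ^ (2 - ρ)), ← h2]
      _ ≤ 2 * C * (c₁ / (2 * C)) * δ ^ (ρ - 1) := by gcongr
      _ = _ := by field_simp
  refine ⟨C * δ, by positivity, fun z hz => ?_⟩
  have hz0 : 0 < z.re := hx₀.trans_le hz
  have hzx : x₀ ≤ ‖z‖ := hz.trans (Complex.re_le_norm z)
  have hzpos : 0 < ‖z‖ := hx₀.trans_le hzx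
  set z₁ : ℂ := z + (δ * ‖z‖ : ℝ) with hz₁
  have hz₁re : z₁.re = z.re + δ * ‖z‖ := by simp [hz₁]
  have hz₁pos : 0 < z₁.re := by rw [hz₁re]; positivity
  have hlow : c₁ * δ ^ (ρ - 1) * ‖z‖ ^ (1 - ρ) ≤ ‖B z₁‖ := by
    have h := harnack_lower_bound hPd hPre hx₀ (by positivity) hPx hz₁pos
    rw [hPnorm _ hz₁pos] at h
    have hn : ‖z₁ + x₀‖ ≤ 3 * ‖z‖ := by
      calc ‖z₁ + x₀‖ ≤ ‖z‖ + ‖((δ * ‖z‖ : ℝ) : ℂ)‖ + ‖(x₀ : ℂ)‖ :=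
            (norm_add_le _ _).trans (by gcongr; exact norm_add_le _ _)
        _ = ‖z‖ + δ * ‖z‖ + x₀ := by
            rw [Complex.norm_real, Complex.norm_real, Real.norm_of_nonneg (by positivity),
              Real.norm_of_nonneg hx₀.le]
        _ ≤ _ := by nlinarith
    have hn0 : 0 < ‖z₁ + x₀‖ := norm_pos_iff.2 fun h => by
      have := congrArg Complex.re h
      simp at this
      linarith
    have h2 : p₀ ^ p * x₀ / 9 * (δ * ‖z‖⁻¹) ≤ ‖B z₁‖ ^ p := by
      refine le_trans ?_ h
      calc p₀ ^ p * x₀ / 9 * (δ * ‖z‖⁻¹) = p₀ ^ p * (x₀ * (δ * ‖z‖) / (3 * ‖z‖) ^ 2) := by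
            field_simp; norm_num
        _ ≤ _ := by
            gcongr
            rw [hz₁re]; linarith
    have h3 := Real.rpow_le_rpow (by positivity) h2 hρ0.le
    rw [hp, Real.rpow_inv_rpow (norm_nonneg _) hρ0.ne',
      Real.mul_rpow (by positivity) (by positivity), Real.mul_rpow (by positivity) (by positivity),
      Real.inv_rpow (by positivity), ← Real.rpow_neg (by positivity)] at h3
    refine le_trans (le_of_eq ?_) h3
    rw [hc₁, hp, neg_sub]
    ring
  have hdiff : ‖B z₁ - B z‖ ≤ C * δ * ‖z‖ ^ (1 - ρ) := by
    have hseg : ∀ w ∈ segment ℝ z z₁, 0 < w.re ∧ ‖z‖ ≤ ‖w‖ := by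
      intro w hw
      rw [segment_eq_image'] at hw
      obtain ⟨t, ⟨ht0, ht1⟩, rfl⟩ := hw
      have ht : 0 ≤ t * (δ * ‖z‖) := by positivity
      have e1 : (z + t • (z₁ - z)).re = z.re + t * (δ * ‖z‖) := by simp [hz₁]
      have e2 : (z + t • (z₁ - z)).im = z.im := by simp [hz₁]
      refine ⟨by simp only [e1]; linarith, ?_⟩
      refine le_of_pow_le_pow_left₀ two_ne_zero (norm_nonneg _) ?_
      simp only [Complex.sq_norm, Complex.normSq_apply, e1, e2]
      nlinarith
    have h := (convex_segment z z₁).norm_image_sub_le_of_norm_deriv_le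
      (𝕜 := ℂ) (f := B) (C := C * ‖z‖ ^ (-ρ)) (fun w hw => hd w (hseg w hw).1)
      (fun w hw => (hderiv w (hseg w hw).1).trans (by
        gcongr C * ?_
        exact Real.rpow_le_rpow_of_nonpos hzpos (hseg w hw).2 (by linarith)))
      (left_mem_segment ℝ z z₁) (right_mem_segment ℝ z z₁)
    refine h.trans (le_of_eq ?_)
    have : ‖z₁ - z‖ = δ * ‖z‖ := by
      rw [hz₁, add_sub_cancel_left, Complex.norm_real, Real.norm_of_nonneg (by positivity)]
    rw [this, show (1 - ρ) = -ρ + 1 by ring, Real.rpow_add_one hzpos.ne']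
    ring
  have h4 : 2 * C * δ * ‖z‖ ^ (1 - ρ) ≤ c₁ * δ ^ (ρ - 1) * ‖z‖ ^ (1 - ρ) := by gcongr
  have h5 := norm_sub_norm_le (B z₁) (B z)
  linarith

/-- Quantitative sectoriality of a holomorphic symbol on the half-plane `re z ≥ x₀`: its values lie
in a sector of half-angle less than `π / 2` and have exact order `|z| ^ (1 - ρ)`. -/
structure IsSectorialSymbol (B : ℂ → ℂ) (ρ x₀ κ c C : ℝ) : Prop where
  one_lt : 1 < ρ
  abscissa_pos : 0 < x₀
  sector_nonneg : 0 ≤ κ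
  sector_lt : κ < 1
  lower_pos : 0 < c
  upper_pos : 0 < C
  diff : ∀ z : ℂ, x₀ ≤ z.re → DifferentiableAt ℂ B z
  re_nonneg : ∀ z : ℂ, x₀ ≤ z.re → 0 ≤ (B z).re
  abs_im_le : ∀ z : ℂ, x₀ ≤ z.re → |(B z).im| ≤ κ * ‖B z‖
  lower : ∀ z : ℂ, x₀ ≤ z.re → c * ‖z‖ ^ (1 - ρ) ≤ ‖B z‖
  upper : ∀ z : ℂ, x₀ ≤ z.re → ‖B z‖ ≤ C * ‖z‖ ^ (1 - ρ)
  deriv_upper : ∀ z : ℂ, x₀ ≤ z.re → ‖deriv B z‖ ≤ C * ‖z‖ ^ (-ρ)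

/-- The function `z / (z + λ B(z))`, that is `z` times the Laplace transform of `s_λ`. -/
def resolventSymbol (B : ℂ → ℂ) (lam : ℝ) (z : ℂ) : ℂ := z / (z + lam * B z)

namespace IsSectorialSymbol

variable {B : ℂ → ℂ} {ρ x₀ κ c C : ℝ}

theorem norm_pos (h : IsSectorialSymbol B ρ x₀ κ c C) {z : ℂ} (hz : x₀ ≤ z.re) : 0 < ‖z‖ :=
  (h.abscissa_pos.trans_le hz).trans_le (Complex.re_le_norm z)

theorem sqrt_mul_le_norm_add (h : IsSectorialSymbol B ρ x₀ κ c C) {lam : ℝ} (hlam : 0 < lam)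
    {z : ℂ} (hz : x₀ ≤ z.re) :
    √((1 - κ) / 2) * (‖z‖ + lam * ‖B z‖) ≤ ‖z + lam * B z‖ := by
  have hn : ‖(lam : ℂ) * B z‖ = lam * ‖B z‖ := by simp [abs_of_pos hlam]
  rw [← hn]
  refine sqrt_mul_add_norm_le_norm_add h.sector_nonneg h.sector_lt (h.abscissa_pos.le.trans hz)
    ?_ ?_
  · simpa using mul_nonneg hlam.le (h.re_nonneg z hz)
  · rw [hn, Complex.im_ofReal_mul, abs_mul, abs_of_pos hlam, mul_left_comm]
    exact mul_le_mul_of_nonneg_left (h.abs_im_le z hz) hlam.le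

theorem sqrt_pos (h : IsSectorialSymbol B ρ x₀ κ c C) : 0 < √((1 - κ) / 2) :=
  Real.sqrt_pos.2 (by linarith [h.sector_lt])

theorem norm_add_pos (h : IsSectorialSymbol B ρ x₀ κ c C) {lam : ℝ} (hlam : 0 < lam)
    {z : ℂ} (hz : x₀ ≤ z.re) : 0 < ‖z + lam * B z‖ := by
  refine lt_of_lt_of_le ?_ (h.sqrt_mul_le_norm_add hlam hz)
  have := h.sqrt_pos
  have := h.norm_pos hz
  positivity

theorem norm_resolventSymbol_le (h : IsSectorialSymbol B ρ x₀ κ c C) {lam : ℝ} (hlam : 0 < lam)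
    {z : ℂ} (hz : x₀ ≤ z.re) :
    ‖resolventSymbol B lam z‖ ≤ (√((1 - κ) / 2))⁻¹ := by
  have h0 := h.sqrt_pos
  rw [resolventSymbol, norm_div, div_le_iff₀ (h.norm_add_pos hlam hz), ← div_eq_inv_mul,
    le_div_iff₀ h0, mul_comm]
  refine le_trans ?_ (h.sqrt_mul_le_norm_add hlam hz)
  gcongr
  have := norm_nonneg (B z)
  nlinarith

theorem norm_resolventSymbol_le_rpow (h : IsSectorialSymbol B ρ x₀ κ c C) {lam : ℝ}
    (hlam : 0 < lam) {z : ℂ} (hz : x₀ ≤ z.re) :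
    ‖resolventSymbol B lam z‖ ≤ (√((1 - κ) / 2))⁻¹ * c⁻¹ * (‖z‖ ^ ρ / lam) := by
  have h0 := h.sqrt_pos
  have hz0 := h.norm_pos hz
  have hc := h.lower_pos
  rw [resolventSymbol, norm_div, div_le_iff₀ (h.norm_add_pos hlam hz)]
  calc ‖z‖ = (√((1 - κ) / 2))⁻¹ * c⁻¹ * (‖z‖ ^ ρ / lam) *
        (√((1 - κ) / 2) * (lam * (c * ‖z‖ ^ (1 - ρ)))) := by
        have : ‖z‖ = ‖z‖ ^ ρ * ‖z‖ ^ (1 - ρ) := by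
          rw [← Real.rpow_add hz0]; simp
        field_simp
        exact this
    _ ≤ (√((1 - κ) / 2))⁻¹ * c⁻¹ * (‖z‖ ^ ρ / lam) *
        (√((1 - κ) / 2) * (‖z‖ + lam * ‖B z‖)) := by
        gcongr
        nlinarith [h.lower z hz]
    _ ≤ _ := by
        gcongr
        exact h.sqrt_mul_le_norm_add hlam hz

theorem norm_resolventSymbol_le_mul (h : IsSectorialSymbol B ρ x₀ κ c C) {lam : ℝ}
    (hlam : 0 < lam) {z : ℂ} (hz : x₀ ≤ z.re) :
    ‖resolventSymbol B lam z‖ ≤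
      (√((1 - κ) / 2))⁻¹ * (1 + c⁻¹) * (lam ^ (-(1 / ρ)) * ‖z‖) := by
  have h0 := h.sqrt_pos
  have hz0 := h.norm_pos hz
  have hc := h.lower_pos
  have hρ0 : 0 < ρ := by linarith [h.one_lt]
  set y := lam ^ (-(1 / ρ)) * ‖z‖ with hy
  have hy0 : 0 < y := by positivity
  have hyρ : ‖z‖ ^ ρ / lam = y ^ ρ := by
    rw [hy, Real.mul_rpow (by positivity) hz0.le, ← Real.rpow_mul hlam.le,
      show -(1 / ρ) * ρ = -1 by field_simp, Real.rpow_neg_one, div_eq_inv_mul]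
  rcases le_total 1 y with h1 | h1
  · refine (h.norm_resolventSymbol_le hlam hz).trans ?_
    have : 0 < c⁻¹ := inv_pos.2 hc
    rw [mul_assoc]
    refine le_mul_of_one_le_right (by positivity) ?_
    nlinarith
  · refine (h.norm_resolventSymbol_le_rpow hlam hz).trans ?_
    rw [hyρ]
    have h2 : y ^ ρ ≤ y := by
      simpa using Real.rpow_le_rpow_of_exponent_ge hy0 h1 h.one_lt.le
    gcongr
    linarith

theorem hasDerivAt_resolventSymbol (h : IsSectorialSymbol B ρ x₀ κ c C) {lam : ℝ}
    (hlam : 0 < lam) {z : ℂ} (hz : x₀ ≤ z.re) :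
    HasDerivAt (resolventSymbol B lam)
      (lam * (B z - z * deriv B z) / (z + lam * B z) ^ 2) z := by
  have h1 := (hasDerivAt_id z).div ((hasDerivAt_id z).add
    ((h.diff z hz).hasDerivAt.const_mul (lam : ℂ))) (_root_.norm_pos_iff.1 (h.norm_add_pos hlam hz))
  refine h1.congr_deriv ?_
  simp
  ring

theorem norm_deriv_resolventSymbol_le (h : IsSectorialSymbol B ρ x₀ κ c C) {lam : ℝ}
    (hlam : 0 < lam) {z : ℂ} (hz : x₀ ≤ z.re) :
    ‖deriv (resolventSymbol B lam) z‖ ≤ 2 * C * c⁻¹ * (√((1 - κ) / 2))⁻¹ ^ 2 / ‖z‖ := by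
  rw [(h.hasDerivAt_resolventSymbol hlam hz).deriv]
  have h0 := h.sqrt_pos
  have hz0 := h.norm_pos hz
  have hc := h.lower_pos
  have hC := h.upper_pos
  set r := √((1 - κ) / 2) with hr
  have hnum : ‖B z - z * deriv B z‖ ≤ 2 * C * ‖z‖ ^ (1 - ρ) := by
    calc _ ≤ ‖B z‖ + ‖z‖ * ‖deriv B z‖ := by
          rw [← norm_mul]; exact norm_sub_le _ _
      _ ≤ C * ‖z‖ ^ (1 - ρ) + ‖z‖ * (C * ‖z‖ ^ (-ρ)) := by
          gcongr
          · exact h.upper z hz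
          · exact h.deriv_upper z hz
      _ = _ := by
          rw [show (1 - ρ) = -ρ + 1 by ring, Real.rpow_add_one hz0.ne']
          ring
  have hden : r ^ 2 * (‖z‖ * (lam * (c * ‖z‖ ^ (1 - ρ)))) ≤ ‖z + lam * B z‖ ^ 2 := by
    calc _ ≤ (r * (‖z‖ + lam * ‖B z‖)) ^ 2 := by
          rw [mul_pow]
          gcongr
          have h1 : lam * (c * ‖z‖ ^ (1 - ρ)) ≤ lam * ‖B z‖ := by
            gcongr; exact h.lower z hz
          have h2 : 0 ≤ lam * ‖B z‖ := by positivity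
          nlinarith
      _ ≤ _ := by
          gcongr
          exact h.sqrt_mul_le_norm_add hlam hz
  have hpos : 0 < ‖z‖ ^ (1 - ρ) := by positivity
  rw [norm_div, norm_mul, norm_pow, Complex.norm_real, Real.norm_of_nonneg hlam.le]
  calc _ ≤ lam * (2 * C * ‖z‖ ^ (1 - ρ)) / (r ^ 2 * (‖z‖ * (lam * (c * ‖z‖ ^ (1 - ρ))))) := by
        gcongr
    _ = _ := by field_simp

end IsSectorialSymbol

/-- The backward Euler symbol `(1 - e^{-hz}) / h`. -/
def eulerSymbol (h : ℝ) (z : ℂ) : ℂ := (1 - Complex.exp (-(h * z))) / h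

theorem norm_one_sub_exp_neg_le {w : ℂ} (hw : 0 ≤ w.re) : ‖1 - Complex.exp (-w)‖ ≤ ‖w‖ := by
  have h := (convex_halfSpace_re_ge 0).norm_image_sub_le_of_norm_deriv_le
      (𝕜 := ℂ) (f := fun w : ℂ => Complex.exp (-w)) (C := 1)
      (fun w _ => by fun_prop) (fun w (hw : 0 ≤ w.re) => by
        have : deriv (fun w : ℂ => Complex.exp (-w)) w = -Complex.exp (-w) := by
          simpa using ((hasDerivAt_id w).neg.cexp).deriv
        rw [this, norm_neg, Complex.norm_exp]
        simpa using hw)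
      (x := w) (y := 0) hw (le_refl (0 : ℝ))
  simpa using h

theorem norm_eulerSymbol_le {h : ℝ} (hh : 0 < h) {z : ℂ} (hz : 0 ≤ z.re) :
    ‖eulerSymbol h z‖ ≤ ‖z‖ := by
  rw [eulerSymbol, norm_div, Complex.norm_real, Real.norm_of_nonneg hh.le, div_le_iff₀ hh]
  refine (norm_one_sub_exp_neg_le ?_).trans (le_of_eq ?_)
  · simpa using mul_nonneg hh.le hz
  · rw [norm_mul, Complex.norm_real, Real.norm_of_nonneg hh.le, mul_comm]

theorem norm_eulerSymbol_sub_le {h : ℝ} (hh : 0 < h) {z : ℂ} (hz : h * ‖z‖ ≤ 1) :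
    ‖eulerSymbol h z - z‖ ≤ h * ‖z‖ ^ 2 := by
  have hn : ‖-((h : ℂ) * z)‖ = h * ‖z‖ := by
    rw [norm_neg, norm_mul, Complex.norm_real, Real.norm_of_nonneg hh.le]
  have h1 := Complex.norm_exp_sub_one_sub_id_le (hn.le.trans hz)
  rw [hn] at h1
  have hh' : (h : ℂ) ≠ 0 := by exact_mod_cast hh.ne'
  have h2 : eulerSymbol h z - z = -(Complex.exp (-(h * z)) - 1 - -(h * z)) / h := by
    rw [eulerSymbol]
    field_simp
    ring
  rw [h2, norm_div, norm_neg, Complex.norm_real, Real.norm_of_nonneg hh.le, div_le_iff₀ hh]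
  linarith

theorem le_re_eulerSymbol {h T : ℝ} (hh : 0 < h) (hT : h ≤ T) {z : ℂ} (hz : z.re = 1) :
    (1 + T)⁻¹ ≤ (eulerSymbol h z).re := by
  have h1 : (eulerSymbol h z).re = (1 - Real.exp (-h) * Real.cos (-(h * z.im))) / h := by
    rw [eulerSymbol, Complex.div_ofReal_re, Complex.sub_re, Complex.exp_re]
    simp [hz]
  rw [h1]
  have h2 : Real.exp (-h) * Real.cos (-(h * z.im)) ≤ (1 + h)⁻¹ := by
    calc _ ≤ Real.exp (-h) * 1 := by gcongr; exact Real.cos_le_one _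
      _ = (Real.exp h)⁻¹ := by rw [mul_one, Real.exp_neg]
      _ ≤ _ := by
        gcongr
        linarith [Real.add_one_le_exp h]
  calc (1 + T)⁻¹ ≤ (1 + h)⁻¹ := by gcongr
    _ = (1 - (1 + h)⁻¹) / h := by field_simp; ring
    _ ≤ _ := by gcongr

theorem IsSectorialSymbol.exists_norm_resolventSymbol_sub_le {B : ℂ → ℂ} {ρ κ c C T : ℝ}
    (hT : 0 < T) (hB : IsSectorialSymbol B ρ (1 + T)⁻¹ κ c C) :
    ∃ M > 0, ∀ lam > 0, ∀ h > 0, h ≤ T → ∀ z : ℂ, z.re = 1 →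
      ‖(resolventSymbol B lam z - resolventSymbol B lam (eulerSymbol h z)) / z‖ ≤
        M * min (min h (lam ^ (-(1 / ρ)))) ‖z‖⁻¹ := by
  have h0 := hB.sqrt_pos
  have hc := hB.lower_pos
  have hC := hB.upper_pos
  set r := (√((1 - κ) / 2))⁻¹ with hr
  have hr0 : 0 < r := inv_pos.2 h0
  set D := 2 * C * c⁻¹ * r ^ 2 with hD
  have hD0 : 0 < D := by positivity
  refine ⟨4 * r + 2 * r * (1 + c⁻¹) + 2 * D, by positivity, fun lam hlam h hh hhT z hz => ?_⟩
  have hx : (1 + T)⁻¹ ≤ z.re := by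
    rw [hz]; exact inv_le_one_of_one_le₀ (by linarith)
  have hψx := le_re_eulerSymbol hh hhT hz
  have hz0 := hB.norm_pos hx
  set ψ := eulerSymbol h z with hψ
  have hψz : ‖ψ‖ ≤ ‖z‖ := norm_eulerSymbol_le hh (by rw [hz]; norm_num)
  set δ := ‖resolventSymbol B lam z - resolventSymbol B lam ψ‖ with hδ
  have hδ0 : 0 ≤ δ := norm_nonneg _
  have b1 : δ ≤ 2 * r := by
    have e1 := hB.norm_resolventSymbol_le hlam hx
    have e2 := hB.norm_resolventSymbol_le hlam hψx
    have := norm_sub_le (resolventSymbol B lam z) (resolventSymbol B lam ψ)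
    linarith
  have b2 : δ ≤ 2 * r * (1 + c⁻¹) * (lam ^ (-(1 / ρ)) * ‖z‖) := by
    have e1 := hB.norm_resolventSymbol_le_mul hlam hx
    have e2 := hB.norm_resolventSymbol_le_mul hlam hψx
    have e3 : r * (1 + c⁻¹) * (lam ^ (-(1 / ρ)) * ‖ψ‖) ≤
        r * (1 + c⁻¹) * (lam ^ (-(1 / ρ)) * ‖z‖) := by gcongr
    have := norm_sub_le (resolventSymbol B lam z) (resolventSymbol B lam ψ)
    linarith
  have b3 : δ ≤ (4 * r + 2 * D) * (h * ‖z‖) := by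
    rcases le_total (h * ‖z‖) (1 / 2) with hs | hs
    · have hsub : ‖ψ - z‖ ≤ h * ‖z‖ ^ 2 := norm_eulerSymbol_sub_le hh (by linarith)
      have hsub' : ‖ψ - z‖ ≤ ‖z‖ / 2 := by nlinarith
      have hseg : ∀ w ∈ segment ℝ z ψ, (1 + T)⁻¹ ≤ w.re ∧ ‖z‖ / 2 ≤ ‖w‖ := by
        intro w hw
        refine ⟨(convex_halfSpace_re_ge (1 + T)⁻¹).segment_subset hx hψx hw, ?_⟩
        have := norm_sub_le_of_mem_segment hw
        have h3 := norm_sub_norm_le z w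
        rw [norm_sub_rev] at h3
        linarith
      have key := (convex_segment z ψ).norm_image_sub_le_of_norm_deriv_le
        (𝕜 := ℂ) (f := resolventSymbol B lam) (C := D / (‖z‖ / 2))
        (fun w hw => (hB.hasDerivAt_resolventSymbol hlam (hseg w hw).1).differentiableAt)
        (fun w hw => (hB.norm_deriv_resolventSymbol_le hlam (hseg w hw).1).trans (by
          gcongr
          exact (hseg w hw).2))
        (left_mem_segment ℝ z ψ) (right_mem_segment ℝ z ψ)
      rw [norm_sub_rev] at key
      calc δ ≤ D / (‖z‖ / 2) * (h * ‖z‖ ^ 2) := key.trans (by gcongr)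
        _ = 2 * D * (h * ‖z‖) := by field_simp
        _ ≤ _ := by gcongr; linarith
    · calc δ ≤ 2 * r := b1
        _ ≤ (4 * r + 2 * D) * (1 / 2) := by linarith
        _ ≤ _ := by gcongr
  rw [norm_div, div_le_iff₀ hz0, ← hδ, mul_assoc,
    min_mul_of_nonneg _ _ hz0.le, min_mul_of_nonneg _ _ hz0.le, inv_mul_cancel₀ hz0.ne']
  have hci : 0 < c⁻¹ := inv_pos.2 hc
  have hL : 0 ≤ lam ^ (-(1 / ρ)) * ‖z‖ := by positivity
  have hhz : 0 ≤ h * ‖z‖ := by positivity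
  have hrc : 0 < r * c⁻¹ := by positivity
  rcases min_choice (min (h * ‖z‖) (lam ^ (-(1 / ρ)) * ‖z‖)) 1 with e | e <;> rw [e]
  · rcases min_choice (h * ‖z‖) (lam ^ (-(1 / ρ)) * ‖z‖) with e | e <;> rw [e]
    · exact b3.trans (by gcongr; nlinarith)
    · exact b2.trans (by gcongr; nlinarith)
  · nlinarith

section Plancherel

open FourierTransform SchwartzMap ContDiff

theorem integral_fourier_mul_eq_flip {f g : ℝ → ℂ} (hf : Integrable f) (hg : Integrable g) :
    ∫ ξ, 𝓕 f ξ * g ξ = ∫ x, f x * 𝓕 g x := by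
  have h := VectorFourier.integral_fourierIntegral_smul_eq_flip (e := Real.fourierChar)
    (μ := volume) (ν := volume) (L := innerₗ ℝ) (f := f) (g := g) Real.continuous_fourierChar
    (by exact continuous_inner) hf hg
  rw [flip_innerₗ] at h
  exact h

theorem coeFn_fourier_toLp {f : ℝ → ℂ} (hf : Integrable f) (hf₂ : MemLp f 2) :
    (𝓕 (hf₂.toLp f) : Lp ℂ 2 (volume : Measure ℝ)) =ᵐ[volume] 𝓕 f := by
  have hcont : Continuous (𝓕 f) :=
    VectorFourier.fourierIntegral_continuous Real.continuous_fourierChar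
      (by exact continuous_inner) hf
  apply ae_eq_of_integral_contDiff_smul_eq
  · exact (Lp.memLp _).locallyIntegrable (by norm_num)
  · exact hcont.locallyIntegrable
  intro g hg hgc
  have hg₁ : HasCompactSupport (Complex.ofRealCLM ∘ g) := hgc.comp_left rfl
  have hg₂ : ContDiff ℝ ∞ (Complex.ofRealCLM ∘ g) := by fun_prop
  set φ : 𝓢(ℝ, ℂ) := hg₁.toSchwartzMap hg₂
  have hφ : ∀ x, φ x = (g x : ℂ) := fun x => rfl
  have h := congrArg (fun D => D φ) (Lp.fourier_toTemperedDistribution_eq (hf₂.toLp f))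
  simp only [TemperedDistribution.fourier_apply, Lp.toTemperedDistribution_apply] at h
  calc ∫ x, g x • (𝓕 (hf₂.toLp f) : Lp ℂ 2 (volume : Measure ℝ)) x
      = ∫ x, φ x • (𝓕 (hf₂.toLp f) : Lp ℂ 2 (volume : Measure ℝ)) x := by
        simp [hφ]
    _ = ∫ x, (𝓕 φ) x • (hf₂.toLp f) x := h.symm
    _ = ∫ x, f x * 𝓕 (φ : ℝ → ℂ) x := by
        apply integral_congr_ae
        filter_upwards [hf₂.coeFn_toLp] with x hx
        rw [hx, smul_eq_mul, mul_comm, SchwartzMap.fourier_coe]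
    _ = ∫ x, 𝓕 f x * φ x := (integral_fourier_mul_eq_flip hf φ.integrable).symm
    _ = ∫ x, g x • 𝓕 f x := by simp [hφ, mul_comm]

theorem eLpNorm_fourier_eq {f : ℝ → ℂ} (hf : Integrable f) (hf₂ : MemLp f 2) :
    eLpNorm (𝓕 f) 2 = eLpNorm f 2 := by
  have h := Lp.norm_fourier_eq (hf₂.toLp f)
  have h2 := congrArg ENNReal.ofReal h
  rw [ofReal_norm, ofReal_norm, Lp.enorm_def, Lp.enorm_def,
    eLpNorm_congr_ae (coeFn_fourier_toLp hf hf₂), eLpNorm_congr_ae hf₂.coeFn_toLp] at h2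
  exact h2

theorem lintegral_enorm_sq_fourier {f : ℝ → ℂ} (hf : Integrable f) (hf₂ : MemLp f 2) :
    ∫⁻ ξ, ‖𝓕 f ξ‖ₑ ^ 2 = ∫⁻ x, ‖f x‖ₑ ^ 2 := by
  have h := congrArg (· ^ (2 : ℝ)) (eLpNorm_fourier_eq hf hf₂)
  simp only [eLpNorm_eq_lintegral_rpow_enorm_toReal (by norm_num : (2 : ℝ≥0∞) ≠ 0) (by norm_num),
    ← ENNReal.rpow_mul] at h
  simpa using h

theorem integral_inner_fourier {f g : ℝ → ℂ} (hf : Integrable f) (hf₂ : MemLp f 2)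
    (hg : Integrable g) (hg₂ : MemLp g 2) :
    ∫ ξ, 𝓕 g ξ * star (𝓕 f ξ) = ∫ x, g x * star (f x) := by
  have h := Lp.inner_fourier_eq (hf₂.toLp f) (hg₂.toLp g)
  rw [L2.inner_def, L2.inner_def] at h
  calc _ = _ := ?_
    _ = _ := h
    _ = _ := ?_
  · apply integral_congr_ae
    filter_upwards [coeFn_fourier_toLp hf hf₂, coeFn_fourier_toLp hg hg₂] with x h1 h2
    rw [h1, h2]; rfl
  · apply integral_congr_ae
    filter_upwards [hf₂.coeFn_toLp, hg₂.coeFn_toLp] with x h1 h2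
    rw [h1, h2]; rfl

end Plancherel

section Kernel

variable {b b' : ℝ → ℝ} {ρ θ : ℝ}

theorem norm_cexp_neg_mul_ofReal (z : ℂ) (t : ℝ) :
    ‖Complex.exp (-z * t)‖ = Real.exp (-z.re * t) := by
  simp [Complex.norm_exp]

namespace Assumption1

theorem continuousOn (hb : Assumption1 b b' ρ) : ContinuousOn b (Ioi 0) :=
  fun t ht => (hb.hasDeriv t ht).continuousAt.continuousWithinAt

theorem integrableOn_exp_mul (hb : Assumption1 b b' ρ) {z : ℂ} (hz : 0 < z.re) :
    IntegrableOn (fun t : ℝ => Complex.exp (-z * t) * (b t : ℂ)) (Ioi 0) := by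
  have hmeas : AEStronglyMeasurable (fun t : ℝ => Complex.exp (-z * t) * (b t : ℂ))
      (volume.restrict (Ioi 0)) := by
    refine ContinuousOn.aestronglyMeasurable ?_ measurableSet_Ioi
    exact (Continuous.continuousOn (by fun_prop)).mul
      (Complex.continuous_ofReal.comp_continuousOn hb.continuousOn)
  rw [← Ioc_union_Ioi_eq_Ioi (zero_le_one (α := ℝ))] at hmeas ⊢
  refine IntegrableOn.union ?_ ?_
  · refine Integrable.mono (hb.locInt 1 one_pos)
      (hmeas.mono_measure (Measure.restrict_mono subset_union_left le_rfl)) ?_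
    filter_upwards [ae_restrict_mem measurableSet_Ioc] with t ht
    rw [norm_mul, norm_cexp_neg_mul_ofReal, Complex.norm_real]
    have : Real.exp (-z.re * t) ≤ 1 := Real.exp_le_one_iff.2 (by nlinarith [ht.1])
    exact mul_le_of_le_one_left (norm_nonneg _) this
  · refine Integrable.mono' ((integrableOn_exp_mul_Ioi (neg_neg_iff_pos.2 hz) 1).mul_const (b 1))
      (hmeas.mono_measure (Measure.restrict_mono subset_union_right le_rfl)) ?_
    filter_upwards [ae_restrict_mem measurableSet_Ioi] with t ht
    have ht' : 1 < t := ht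
    rw [norm_mul, norm_cexp_neg_mul_ofReal, Complex.norm_real, Real.norm_eq_abs,
      abs_of_nonneg (hb.nonneg t (by linarith))]
    gcongr
    exact hb.anti (mem_Ioi.2 one_pos) (mem_Ioi.2 (by linarith)) ht'.le

theorem exists_laplaceTransform_eq_ofReal (hb : Assumption1 b b' ρ) {x : ℝ} (hx : 0 < x) :
    ∃ p : ℝ, 0 < p ∧ laplaceTransform b x = p := by
  refine ⟨∫ t in Ioi (0 : ℝ), Real.exp (-x * t) * b t, ?_, ?_⟩
  · have hint : IntegrableOn (fun t => Real.exp (-x * t) * b t) (Ioi 0) := by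
      have h := (hb.integrableOn_exp_mul (z := x) (by simpa using hx)).re
      refine h.congr (ae_of_all _ fun t => ?_)
      have : Complex.exp (-(x : ℂ) * t) * (b t : ℂ) = ((Real.exp (-x * t) * b t : ℝ) : ℂ) := by
        push_cast; rfl
      show (Complex.exp (-(x : ℂ) * t) * (b t : ℂ)).re = _
      rw [this, Complex.ofReal_re]
    obtain ⟨t₀, ht₀, hne⟩ := hb.ne_zero
    have hpos : 0 < b t₀ := lt_of_le_of_ne (hb.nonneg t₀ ht₀) (Ne.symm hne)
    have hnn : 0 ≤ᵐ[volume.restrict (Ioi (0 : ℝ))] fun t => Real.exp (-x * t) * b t := by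
      filter_upwards [ae_restrict_mem measurableSet_Ioi] with t ht
      exact mul_nonneg (Real.exp_pos _).le (hb.nonneg t ht)
    rw [setIntegral_pos_iff_support_of_nonneg_ae hnn hint]
    refine lt_of_lt_of_le ?_ (measure_mono (s := Ioc 0 t₀) ?_)
    · simpa using ht₀
    · intro t ht
      refine ⟨?_, ht.1⟩
      have : b t₀ ≤ b t := hb.anti ht.1 ht₀ ht.2
      exact (mul_pos (Real.exp_pos _) (by linarith)).ne'
  · rw [laplaceTransform, ← integral_complex_ofReal]
    congr 1; ext t; push_cast; rfl

theorem abs_arg_laplaceTransform_le (hb : Assumption1 b b' ρ) {z : ℂ} (hz : 0 < z.re) :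
    |(laplaceTransform b z).arg| ≤ (ρ - 1) * (Real.pi / 2) := by
  have h : |(laplaceTransform b z).arg| ≤
      sSup {θ : ℝ | ∃ z : ℂ, 0 < z.re ∧ θ = |(laplaceTransform b z).arg|} := by
    refine le_csSup ⟨Real.pi, ?_⟩ ⟨z, hz, rfl⟩
    rintro _ ⟨w, _, rfl⟩
    exact Complex.abs_arg_le_pi _
  refine h.trans (le_of_eq ?_)
  have := hb.rho_eq
  have hpi := Real.pi_pos
  rw [this]; field_simp; ring

theorem re_laplaceTransform_nonneg (hb : Assumption1 b b' ρ) {z : ℂ} (hz : 0 < z.re) :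
    0 ≤ (laplaceTransform b z).re :=
  Complex.abs_arg_le_pi_div_two_iff.1 ((hb.abs_arg_laplaceTransform_le hz).trans
    (by nlinarith [hb.rho_mem.2, Real.pi_pos]))

theorem exists_isSectorialSymbol (hb : Assumption1 b b' ρ) (hb2 : Assumption2 b ρ θ) {x₀ : ℝ}
    (hx₀ : 0 < x₀) : ∃ (B : ℂ → ℂ) (κ c C : ℝ), IsSectorialSymbol B ρ x₀ κ c C ∧
      ∀ z : ℂ, 0 < z.re → B z = laplaceTransform b z := by
  obtain ⟨B, hd, hBb, C, hC, hup, hder⟩ := hb2.holo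
  have hmem : ∀ z : ℂ, 0 < z.re → z ≠ 0 ∧ |z.arg| < θ := fun z hz =>
    ⟨fun h => by simp [h] at hz, (Complex.abs_arg_lt_pi_div_two_iff.2 (Or.inl hz)).trans
      hb2.theta_gt⟩
  have hpi := Real.pi_pos
  obtain ⟨hρ1, hρ2⟩ := hb.rho_mem
  have harg : ∀ z : ℂ, 0 < z.re → |(B z).arg| ≤ (ρ - 1) * (Real.pi / 2) := fun z hz => by
    rw [hBb z hz]; exact hb.abs_arg_laplaceTransform_le hz
  obtain ⟨p, hp, hpB⟩ := hb.exists_laplaceTransform_eq_ofReal hx₀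
  obtain ⟨c, hc, hlow⟩ := exists_rpow_le_norm_of_abs_arg_le hb.rho_mem hC hx₀ hp
    ((hBb x₀ (by simpa using hx₀)).trans hpB) (fun z hz => hd z (hmem z hz).1 (hmem z hz).2)
    harg (fun z hz => hder z (hmem z hz).1 (hmem z hz).2)
  have hpos : ∀ z : ℂ, x₀ ≤ z.re → 0 < z.re := fun z hz => hx₀.trans_le hz
  have hA : (ρ - 1) * (Real.pi / 2) < Real.pi / 2 := by nlinarith
  have hA0 : 0 ≤ (ρ - 1) * (Real.pi / 2) := by nlinarith
  refine ⟨B, Real.sin ((ρ - 1) * (Real.pi / 2)), c, C, ?_, hBb⟩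
  constructor
  · exact hρ1
  · exact hx₀
  · exact Real.sin_nonneg_of_nonneg_of_le_pi hA0 (by linarith)
  · exact (Real.sin_lt_sin_of_lt_of_le_pi_div_two (by linarith) le_rfl hA).trans_eq
      Real.sin_pi_div_two
  · exact hc
  · exact hC
  · exact fun z hz => hd z (hmem z (hpos z hz)).1 (hmem z (hpos z hz)).2
  · intro z hz
    rw [hBb z (hpos z hz)]
    exact hb.re_laplaceTransform_nonneg (hpos z hz)
  · intro z hz
    have h1 := harg z (hpos z hz)
    have h2 : |Real.sin (B z).arg| = Real.sin |(B z).arg| := by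
      rcases abs_cases (B z).arg with ⟨h, h'⟩ | ⟨h, h'⟩
      · rw [h, abs_of_nonneg (Real.sin_nonneg_of_nonneg_of_le_pi h' (Complex.arg_le_pi _))]
      · rw [h, Real.sin_neg, abs_of_nonpos
          (Real.sin_nonpos_of_nonpos_of_neg_pi_le h'.le (Complex.neg_pi_lt_arg _).le)]
    have h3 : (B z).im = ‖B z‖ * Real.sin (B z).arg := (Complex.norm_mul_sin_arg _).symm
    rw [h3, abs_mul, abs_of_nonneg (norm_nonneg _), h2, mul_comm]
    gcongr
    exact Real.sin_le_sin_of_le_of_le_pi_div_two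
      (by linarith [abs_nonneg (B z).arg]) (by linarith) h1
  · exact hlow
  · exact fun z hz => hup z (hmem z (hpos z hz)).1 (hmem z (hpos z hz)).2
  · exact fun z hz => hder z (hmem z (hpos z hz)).1 (hmem z (hpos z hz)).2

end Assumption1

end Kernel

section ScalarResolvent

open FourierTransform Convolution

theorem memLp_two_of_integrable_of_bound {α : Type*} {m : MeasurableSpace α} {μ : Measure α}
    {f : α → ℂ} (hf : Integrable f μ) {M : ℝ} (hM : ∀ x, ‖f x‖ ≤ M) : MemLp f 2 μ := by
  rw [memLp_two_iff_integrable_sq_norm hf.1]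
  refine (hf.norm.const_mul M).mono' (hf.1.norm.pow 2) (ae_of_all _ fun x => ?_)
  rw [Real.norm_eq_abs, abs_of_nonneg (by positivity), sq]
  exact mul_le_mul_of_nonneg_right (hM x) (norm_nonneg _)

theorem fourier_indicator_exp_mul (f : ℝ → ℂ) (x ξ : ℝ) :
    𝓕 (indicator (Ioi 0) fun t : ℝ => Complex.exp (-(x : ℂ) * t) * f t) ξ =
      ∫ t in Ioi (0 : ℝ), Complex.exp (-(x + (2 * Real.pi * ξ : ℝ) * Complex.I) * t) * f t := by
  rw [Real.fourier_real_eq_integral_exp_smul, ← integral_indicator measurableSet_Ioi]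
  congr 1; ext t
  by_cases ht : t ∈ Ioi (0 : ℝ)
  · rw [indicator_of_mem ht, indicator_of_mem ht, smul_eq_mul, ← mul_assoc, ← Complex.exp_add]
    congr 2; push_cast; ring
  · rw [indicator_of_notMem ht, indicator_of_notMem ht, smul_zero]

theorem re_integral_nonneg {α : Type*} {m : MeasurableSpace α} {μ : Measure α} {f : α → ℂ}
    (hf : ∀ x, 0 ≤ (f x).re) : 0 ≤ (∫ x, f x ∂μ).re := by
  by_cases h : Integrable f μ
  · exact (integral_nonneg hf).trans_eq (integral_re h)
  · simp [integral_undef h]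

/-- Convolution with a kernel whose Fourier transform has nonnegative real part is a
positive operator. -/
theorem re_integral_convolution_mul_star_nonneg {k w : ℝ → ℂ} (hk : Integrable k)
    (hw : Integrable w) {M : ℝ} (hM : ∀ x, ‖w x‖ ≤ M) (hre : ∀ ξ, 0 ≤ (𝓕 k ξ).re) :
    0 ≤ (∫ x, (k ⋆[ContinuousLinearMap.mul ℂ ℂ] w) x * star (w x)).re := by
  have hc : Integrable (k ⋆[ContinuousLinearMap.mul ℂ ℂ] w) := hk.integrable_convolution _ hw
  have hbound : ∀ x, ‖(k ⋆[ContinuousLinearMap.mul ℂ ℂ] w) x‖ ≤ (∫ t, ‖k t‖) * M := fun x => by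
    rw [convolution_def, ← integral_mul_const]
    refine norm_integral_le_of_norm_le (hk.norm.mul_const _) (ae_of_all _ fun t => ?_)
    simp only [ContinuousLinearMap.mul_apply', norm_mul]
    gcongr
    exact hM _
  rw [← integral_inner_fourier hw (memLp_two_of_integrable_of_bound hw hM) hc
    (memLp_two_of_integrable_of_bound hc hbound)]
  refine re_integral_nonneg fun ξ => ?_
  rw [Real.fourier_mul_convolution_eq hk hw, mul_assoc]
  have : 𝓕 w ξ * star (𝓕 w ξ) = ((‖𝓕 w ξ‖ ^ 2 : ℝ) : ℂ) := by
    push_cast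
    exact Complex.mul_conj' _
  rw [this, Complex.re_mul_ofReal]
  exact mul_nonneg (hre ξ) (by positivity)

namespace IsScalarSolution

variable {b b' : ℝ → ℝ} {ρ lam : ℝ} {s s' : ℝ → ℝ}

theorem exp_mul_deriv_eq (hs : IsScalarSolution b lam s s') (z : ℂ) {t : ℝ} (ht : 0 < t) :
    Complex.exp (-z * t) * s' t = -lam * ∫ u in (0 : ℝ)..t,
      (Complex.exp (-z * u) * b u) * (Complex.exp (-z * (t - u : ℝ)) * s (t - u)) := by
  have h1 : ∫ u in (0 : ℝ)..t, b (t - u) * s u = ∫ u in (0 : ℝ)..t, b u * s (t - u) := by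
    have := intervalIntegral.integral_comp_sub_left (fun u => b u * s (t - u)) t (a := 0) (b := t)
    simpa using this
  have h2 : ∫ u in (0 : ℝ)..t,
      (Complex.exp (-z * u) * b u) * (Complex.exp (-z * (t - u : ℝ)) * s (t - u)) =
      Complex.exp (-z * t) * ((∫ u in (0 : ℝ)..t, b u * s (t - u) : ℝ) : ℂ) := by
    rw [← intervalIntegral.integral_ofReal, ← intervalIntegral.integral_const_mul]
    refine intervalIntegral.integral_congr fun u _ => ?_
    have : Complex.exp (-z * t) = Complex.exp (-z * u) * Complex.exp (-z * (t - u : ℝ)) := by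
      rw [← Complex.exp_add]; congr 1; push_cast; ring
    simp only [this]; push_cast; ring
  have h3 := hs.eqn t ht
  rw [h1] at h3
  rw [h2, eq_neg_of_add_eq_zero_left h3]
  push_cast; ring

theorem continuousOn_exp_mul (hs : IsScalarSolution b lam s s') (z : ℂ) :
    ContinuousOn (fun t : ℝ => Complex.exp (-z * t) * (s t : ℂ)) (Ici 0) :=
  (Continuous.continuousOn (by fun_prop)).mul (Complex.continuous_ofReal.comp_continuousOn hs.cont)

end IsScalarSolution

end ScalarResolvent

namespace IsScalarSolution

open FourierTransform Convolution

variable {b b' : ℝ → ℝ} {ρ lam : ℝ} {s s' : ℝ → ℝ}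

theorem sq_exp_mul_le_one (hb : Assumption1 b b' ρ) (hlam : 0 < lam)
    (hs : IsScalarSolution b lam s s') {ε τ : ℝ} (hε : 0 < ε) (hτ : 0 < τ) :
    (Real.exp (-ε * τ) * s τ) ^ 2 ≤ 1 := by
  set k : ℝ → ℂ := fun t => Complex.exp (-(ε : ℂ) * t) * b t with hk_def
  set w : ℝ → ℂ := fun t => Complex.exp (-(ε : ℂ) * t) * s t with hw_def
  set w' : ℝ → ℂ := indicator (Iic τ) w with hw'_def
  have hwcont : ContinuousOn w (Ici 0) := hs.continuousOn_exp_mul ε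
  have hkint : IntegrableOn k (Ioi 0) := hb.integrableOn_exp_mul (z := ε) (by simpa using hε)
  have hwint : IntegrableOn w' (Ioi 0) := by
    rw [IntegrableOn, integrable_indicator_iff measurableSet_Iic, IntegrableOn,
      Measure.restrict_restrict measurableSet_Iic, inter_comm, Ioi_inter_Iic]
    exact ((hwcont.mono Icc_subset_Ici_self).integrableOn_compact isCompact_Icc).mono_set
      Ioc_subset_Icc_self
  obtain ⟨M, hM⟩ := (isCompact_Icc (a := (0 : ℝ)) (b := τ)).exists_bound_of_continuousOn
    (hwcont.mono Icc_subset_Ici_self)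
  have hbd : ∀ x, ‖indicator (Ioi 0) w' x‖ ≤ M := fun x => by
    have hM0 : 0 ≤ M := (norm_nonneg _).trans (hM 0 ⟨le_rfl, hτ.le⟩)
    by_cases hx : x ∈ Ioi (0 : ℝ)
    · by_cases hx' : x ∈ Iic τ
      · rw [indicator_of_mem hx, hw'_def, indicator_of_mem hx']
        exact hM x ⟨le_of_lt hx, hx'⟩
      · rw [indicator_of_mem hx, hw'_def, indicator_of_notMem hx']; simpa
    · rw [indicator_of_notMem hx]; simpa
  have hk' : Integrable (indicator (Ioi 0) k) := (integrable_indicator_iff measurableSet_Ioi).2 hkint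
  have hw' : Integrable (indicator (Ioi 0) w') :=
    (integrable_indicator_iff measurableSet_Ioi).2 hwint
  have hpos := re_integral_convolution_mul_star_nonneg hk' hw' hbd (fun ξ => by
    rw [hk_def, fourier_indicator_exp_mul (fun t => (b t : ℂ))]
    exact hb.re_laplaceTransform_nonneg (by simpa using hε))
  have hcint : Integrable fun x => (indicator (Ioi 0) k ⋆[ContinuousLinearMap.mul ℂ ℂ]
      indicator (Ioi 0) w') x * star (indicator (Ioi 0) w' x) := by
    refine (hk'.integrable_convolution (ContinuousLinearMap.mul ℂ ℂ) hw').mul_bdd (c := M)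
      hw'.1.star (ae_of_all _ fun x => ?_)
    rw [norm_star]; exact hbd x
  set g : ℝ → ℝ := fun x => Real.exp (-(2 * ε) * x) * (s' x * s x)
  have hform : ∀ x, (indicator (Ioi 0) k ⋆[ContinuousLinearMap.mul ℂ ℂ]
      indicator (Ioi 0) w') x * star (indicator (Ioi 0) w' x) =
      ((indicator (Ioc 0 τ) (fun x => -lam⁻¹ * g x) x : ℝ) : ℂ) := fun x => by
    by_cases hx : x ∈ Ioc 0 τ
    · rw [indicator_of_mem hx, indicator_of_mem (show x ∈ Ioi 0 from hx.1), hw'_def,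
        indicator_of_mem (show x ∈ Iic τ from hx.2), ← hw'_def]
      have h1 := congrFun (posConvolution_eq_convolution_indicator k w'
        (ContinuousLinearMap.mul ℝ ℂ) volume) x
      have h1' : (indicator (Ioi 0) k ⋆[ContinuousLinearMap.mul ℂ ℂ] indicator (Ioi 0) w') x =
          ∫ u in (0 : ℝ)..x, (Complex.exp (-(ε : ℂ) * u) * b u) *
            (Complex.exp (-(ε : ℂ) * (x - u : ℝ)) * s (x - u)) := by
        refine h1.symm.trans ?_
        rw [posConvolution, indicator_of_mem (show x ∈ Ioi 0 from hx.1)]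
        refine intervalIntegral.integral_congr fun u hu => ?_
        rw [uIcc_of_le hx.1.le] at hu
        have : x - u ∈ Iic τ := by
          have h1 := hu.1; have h2 := hx.2
          show x - u ≤ τ
          linarith
        simp only [ContinuousLinearMap.mul_apply', hw'_def, indicator_of_mem this, hk_def, hw_def]
      have h2 := hs.exp_mul_deriv_eq (ε : ℂ) hx.1
      have h3 : (lam : ℂ) ≠ 0 := by exact_mod_cast hlam.ne'
      rw [h1']
      have h4 : ∫ u in (0 : ℝ)..x, (Complex.exp (-(ε : ℂ) * u) * b u) *
            (Complex.exp (-(ε : ℂ) * (x - u : ℝ)) * s (x - u)) =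
          -(lam : ℂ)⁻¹ * (Complex.exp (-(ε : ℂ) * x) * s' x) := by
        rw [h2]; field_simp
      have h5 : star (w x) = w x := by
        have : w x = ((Real.exp (-ε * x) * s x : ℝ) : ℂ) := by simp [hw_def]
        rw [this]; exact Complex.conj_ofReal _
      have h6 : ((Real.exp (-(2 * ε) * x) : ℝ) : ℂ) =
          Complex.exp (-(ε : ℂ) * x) * Complex.exp (-(ε : ℂ) * x) := by
        rw [← Complex.exp_add]; push_cast; congr 1; ring
      rw [h4, h5]
      simp only [g, hw_def]
      push_cast [h6]
      ring
    · rw [indicator_of_notMem hx]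
      have : indicator (Ioi 0) w' x = 0 := by
        rw [hw'_def, indicator_indicator, Ioi_inter_Iic, indicator_of_notMem hx]
      rw [this]; simp
  simp_rw [hform] at hpos hcint
  rw [integral_complex_ofReal, Complex.ofReal_re, integral_indicator measurableSet_Ioc,
    integral_const_mul] at hpos
  have hgint : IntegrableOn g (Ioc 0 τ) := by
    have h1 : IntegrableOn (fun x => -lam⁻¹ * g x) (Ioc 0 τ) :=
      (integrable_indicator_iff measurableSet_Ioc).1 (by simpa using hcint.re)
    have h2 : g = fun x => -lam * (-lam⁻¹ * g x) := by
      ext x; field_simp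
    rw [h2]
    exact h1.const_mul _
  have hg0 : ∫ x in Ioc 0 τ, g x ≤ 0 := by
    have : 0 < lam⁻¹ := inv_pos.2 hlam
    nlinarith
  have hscont : ContinuousOn s (Icc 0 τ) := hs.cont.mono Icc_subset_Ici_self
  have hFcont : ContinuousOn (fun x => Real.exp (-(2 * ε) * x) * s x ^ 2) (Icc 0 τ) :=
    (Continuous.continuousOn (by fun_prop)).mul (hscont.pow 2)
  have hqint : IntervalIntegrable (fun x => 2 * ε * (Real.exp (-(2 * ε) * x) * s x ^ 2)) volume
      0 τ := by
    refine (hFcont.const_smul (2 * ε)).intervalIntegrable_of_Icc hτ.le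
  have hgint' : IntervalIntegrable (fun x => 2 * g x) volume 0 τ :=
    ((intervalIntegrable_iff_integrableOn_Ioc_of_le hτ.le).2 hgint).const_mul 2
  have hFTC := intervalIntegral.integral_eq_sub_of_hasDerivAt_of_le hτ.le hFcont
    (f' := fun x => 2 * g x - 2 * ε * (Real.exp (-(2 * ε) * x) * s x ^ 2))
    (fun x hx => by
      have h1 := hs.hasDeriv x hx.1
      have h2 : HasDerivAt (fun x : ℝ => Real.exp (-(2 * ε) * x))
          (Real.exp (-(2 * ε) * x) * (-(2 * ε) * 1)) x :=
        ((hasDerivAt_id x).const_mul _).exp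
      refine (h2.mul (h1.pow 2)).congr_deriv ?_
      simp only [g, Pi.pow_apply]; push_cast; ring) (hgint'.sub hqint)
  rw [intervalIntegral.integral_sub hgint' hqint, intervalIntegral.integral_const_mul,
    intervalIntegral.integral_of_le hτ.le (f := g), hs.init] at hFTC
  have hq0 : 0 ≤ ∫ x in (0 : ℝ)..τ, 2 * ε * (Real.exp (-(2 * ε) * x) * s x ^ 2) :=
    intervalIntegral.integral_nonneg hτ.le fun x _ => by positivity
  have : (Real.exp (-ε * τ) * s τ) ^ 2 = Real.exp (-(2 * ε) * τ) * s τ ^ 2 := by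
    rw [mul_pow, sq (Real.exp _), ← Real.exp_add]; ring_nf
  rw [this]
  simp at hFTC
  simp at hg0 hq0 ⊢
  linarith

theorem abs_le_one (hb : Assumption1 b b' ρ) (hlam : 0 < lam)
    (hs : IsScalarSolution b lam s s') {t : ℝ} (ht : 0 ≤ t) : |s t| ≤ 1 := by
  rcases ht.eq_or_lt with rfl | ht
  · simp [hs.init]
  rw [← sq_le_one_iff_abs_le_one]
  have hlim : Tendsto (fun ε : ℝ => (Real.exp (-ε * t) * s t) ^ 2) (nhdsWithin 0 (Ioi 0))
      (nhds ((Real.exp (-0 * t) * s t) ^ 2)) :=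
    (Continuous.tendsto (by fun_prop) _).mono_left nhdsWithin_le_nhds
  have := le_of_tendsto hlim (by
    filter_upwards [self_mem_nhdsWithin] with ε hε
    exact hs.sq_exp_mul_le_one hb hlam hε ht)
  simpa using this

theorem integrableOn_exp_mul (hb : Assumption1 b b' ρ) (hlam : 0 < lam)
    (hs : IsScalarSolution b lam s s') {z : ℂ} (hz : 0 < z.re) :
    IntegrableOn (fun t : ℝ => Complex.exp (-z * t) * (s t : ℂ)) (Ioi 0) := by
  refine Integrable.mono' (integrableOn_exp_mul_Ioi (neg_neg_iff_pos.2 hz) 0)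
    (((hs.continuousOn_exp_mul z).mono Ioi_subset_Ici_self).aestronglyMeasurable
      measurableSet_Ioi) ?_
  filter_upwards [ae_restrict_mem measurableSet_Ioi] with t ht
  rw [norm_mul, norm_cexp_neg_mul_ofReal, Complex.norm_real]
  exact mul_le_of_le_one_right (Real.exp_pos _).le (hs.abs_le_one hb hlam (le_of_lt ht))

theorem mul_laplaceTransform (hb : Assumption1 b b' ρ) (hlam : 0 < lam)
    (hs : IsScalarSolution b lam s s') {z : ℂ} (hz : 0 < z.re) :
    (z + lam * laplaceTransform b z) * laplaceTransform s z = 1 := by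
  have hsint := hs.integrableOn_exp_mul hb hlam hz
  have hbint := hb.integrableOn_exp_mul hz
  have hint : IntegrableOn (fun t : ℝ => Complex.exp (-z * t) * s' t) (Ioi 0) := by
    have h := ((integrable_posConvolution hbint hsint
      (ContinuousLinearMap.mul ℝ ℂ)).const_mul (-lam : ℂ)).integrableOn (s := Ioi 0)
    refine h.congr_fun (fun t ht => ?_) measurableSet_Ioi
    rw [hs.exp_mul_deriv_eq z ht]
    simp only [posConvolution, indicator_of_mem ht, ContinuousLinearMap.mul_apply']
  have hval : ∫ t in Ioi (0 : ℝ), Complex.exp (-z * t) * s' t =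
      -lam * (laplaceTransform b z * laplaceTransform s z) := by
    have h := integral_posConvolution hbint hsint (ContinuousLinearMap.mul ℝ ℂ)
    simp only [ContinuousLinearMap.mul_apply'] at h
    rw [laplaceTransform, laplaceTransform, ← h, ← integral_const_mul]
    refine setIntegral_congr_fun measurableSet_Ioi fun t ht => ?_
    exact hs.exp_mul_deriv_eq z ht
  have hder : ∀ t ∈ Ioi (0 : ℝ), HasDerivAt (fun t : ℝ => Complex.exp (-z * t) * (s t : ℂ))
      (Complex.exp (-z * t) * s' t - z * (Complex.exp (-z * t) * s t)) t := fun t ht => by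
    have h1 : HasDerivAt (fun t : ℝ => Complex.exp (-z * t)) (Complex.exp (-z * t) * (-z * 1)) t :=
      ((Complex.ofRealCLM.hasDerivAt (x := t)).const_mul (-z)).cexp
    refine (h1.mul (hs.hasDeriv t ht).ofReal_comp).congr_deriv ?_
    ring
  have hlim : Tendsto (fun t : ℝ => Complex.exp (-z * t) * (s t : ℂ)) atTop (nhds 0) := by
    refine squeeze_zero_norm' (a := fun t => Real.exp (-z.re * t)) ?_ ?_
    · filter_upwards [eventually_ge_atTop 0] with t ht
      rw [norm_mul, norm_cexp_neg_mul_ofReal, Complex.norm_real]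
      exact mul_le_of_le_one_right (Real.exp_pos _).le (hs.abs_le_one hb hlam ht)
    · exact Real.tendsto_exp_atBot.comp (tendsto_id.const_mul_atTop_of_neg (neg_neg_iff_pos.2 hz))
  have h := integral_Ioi_of_hasDerivAt_of_tendsto
    (hs.continuousOn_exp_mul z 0 self_mem_Ici) hder (hint.sub (hsint.const_mul z)) hlim
  rw [integral_sub hint (hsint.const_mul z), hval, integral_const_mul] at h
  simp only [hs.init] at h
  simp only [laplaceTransform] at h ⊢
  simp at h ⊢
  linear_combination -h

end IsScalarSolution

section GammaAverage

/-- The density of the Gamma distribution with shape `j + 1` and rate one. -/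
def gammaWeight (j : ℕ) (v : ℝ) : ℝ := Real.exp (-v) * v ^ j / (j.factorial : ℝ)

theorem gammaWeight_nonneg (j : ℕ) {v : ℝ} (hv : 0 ≤ v) : 0 ≤ gammaWeight j v := by
  unfold gammaWeight; positivity

theorem integrableOn_gammaWeight (j : ℕ) : IntegrableOn (gammaWeight j) (Ioi 0) := by
  have h := (Real.GammaIntegral_convergent (s := j + 1) (by positivity)).div_const
    (j.factorial : ℝ)
  simp only [add_sub_cancel_right, Real.rpow_natCast] at h
  exact h

theorem integral_gammaWeight (j : ℕ) : ∫ v in Ioi (0 : ℝ), gammaWeight j v = 1 := by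
  have h := Real.Gamma_eq_integral (s := j + 1) (by positivity)
  rw [Real.Gamma_nat_eq_factorial] at h
  simp only [add_sub_cancel_right, Real.rpow_natCast] at h
  simp only [gammaWeight]
  rw [integral_div, ← h, div_self (by positivity)]

/-- The average of `f (h ·)` against the Gamma density of shape `j + 1`. -/
def gammaAverage (f : ℝ → ℝ) (h : ℝ) (j : ℕ) : ℝ := ∫ v in Ioi (0 : ℝ), gammaWeight j v * f (h * v)

variable {f : ℝ → ℝ} {h : ℝ}

theorem integrableOn_gammaWeight_mul (hf : ContinuousOn f (Ici 0)) (hf1 : ∀ t, 0 ≤ t → |f t| ≤ 1)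
    (hh : 0 < h) (j : ℕ) : IntegrableOn (fun v => gammaWeight j v * f (h * v)) (Ioi 0) := by
  have hmaps : MapsTo (fun v : ℝ => h * v) (Ioi 0) (Ici 0) := fun v hv =>
    (mul_pos hh hv).le
  refine (integrableOn_gammaWeight j).mul_bdd (c := 1) ((hf.comp
    (Continuous.continuousOn (by fun_prop)) hmaps).aestronglyMeasurable measurableSet_Ioi) ?_
  filter_upwards [ae_restrict_mem measurableSet_Ioi] with v hv
  exact hf1 _ (hmaps hv)

theorem abs_gammaAverage_le_one (hf1 : ∀ t, 0 ≤ t → |f t| ≤ 1) (hh : 0 < h) (j : ℕ) :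
    |gammaAverage f h j| ≤ 1 := by
  rw [← integral_gammaWeight j]
  refine norm_integral_le_of_norm_le (f := fun v => gammaWeight j v * f (h * v))
    (integrableOn_gammaWeight j) ?_
  filter_upwards [ae_restrict_mem measurableSet_Ioi] with v hv
  rw [norm_mul, Real.norm_eq_abs, abs_of_nonneg (gammaWeight_nonneg j (le_of_lt hv))]
  exact mul_le_of_le_one_right (gammaWeight_nonneg j (le_of_lt hv)) (hf1 _ (mul_pos hh hv).le)

theorem hasSum_gammaAverage_mul_pow (hf : ContinuousOn f (Ici 0))
    (hf1 : ∀ t, 0 ≤ t → |f t| ≤ 1) (hh : 0 < h) {ζ : ℂ} (hζ : ‖ζ‖ < 1) :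
    HasSum (fun j => (gammaAverage f h j : ℂ) * ζ ^ j) (laplaceTransform f ((1 - ζ) / h) / h) := by
  have hint : ∀ j : ℕ, Integrable (fun v : ℝ => ((gammaWeight j v * f (h * v) : ℝ) : ℂ) * ζ ^ j)
      (volume.restrict (Ioi 0)) := fun j =>
    (integrableOn_gammaWeight_mul hf hf1 hh j).ofReal.mul_const _
  have hsum : Summable fun j : ℕ => ∫ v in Ioi (0 : ℝ),
      ‖((gammaWeight j v * f (h * v) : ℝ) : ℂ) * ζ ^ j‖ := by
    refine Summable.of_nonneg_of_le (fun j => integral_nonneg fun v => norm_nonneg _) (fun j => ?_)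
      (summable_geometric_of_lt_one (norm_nonneg ζ) hζ)
    calc ∫ v in Ioi (0 : ℝ), ‖((gammaWeight j v * f (h * v) : ℝ) : ℂ) * ζ ^ j‖
        ≤ ∫ v in Ioi (0 : ℝ), gammaWeight j v * ‖ζ‖ ^ j := by
          refine setIntegral_mono_on (hint j).norm ((integrableOn_gammaWeight j).mul_const _)
            measurableSet_Ioi fun v hv => ?_
          rw [norm_mul, norm_pow, Complex.norm_real, norm_mul, Real.norm_eq_abs,
            abs_of_nonneg (gammaWeight_nonneg j (le_of_lt hv))]
          gcongr
          exact mul_le_of_le_one_right (gammaWeight_nonneg j (le_of_lt hv))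
            (hf1 _ (mul_pos hh hv).le)
      _ = ‖ζ‖ ^ j := by rw [integral_mul_const, integral_gammaWeight, one_mul]
  have key := hasSum_integral_of_summable_integral_norm hint hsum
  have hterm : ∀ j : ℕ, ∫ v in Ioi (0 : ℝ), ((gammaWeight j v * f (h * v) : ℝ) : ℂ) * ζ ^ j =
      (gammaAverage f h j : ℂ) * ζ ^ j := fun j => by
    rw [integral_mul_const, integral_complex_ofReal]; rfl
  simp_rw [hterm] at key
  have hpt : ∀ v : ℝ, ∑' j : ℕ, ((gammaWeight j v * f (h * v) : ℝ) : ℂ) * ζ ^ j =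
      Complex.exp (-((1 - ζ) / h) * (h * v : ℝ)) * f (h * v) := fun v => by
    have h1 : HasSum (fun j : ℕ => (v * ζ) ^ j / (j.factorial : ℂ)) (Complex.exp (v * ζ)) := by
      rw [Complex.exp_eq_exp_ℂ]; exact NormedSpace.expSeries_div_hasSum_exp _
    have h2 := h1.mul_left (Complex.exp (-v) * f (h * v))
    have h3 : Complex.exp (-((1 - ζ) / h) * (h * v : ℝ)) =
        Complex.exp (-v) * Complex.exp (v * ζ) := by
      rw [← Complex.exp_add]; congr 1
      have : (h : ℂ) ≠ 0 := by exact_mod_cast hh.ne'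
      push_cast; field_simp; ring
    rw [h3, mul_right_comm, ← h2.tsum_eq]
    congr 1; ext j
    simp only [gammaWeight]; push_cast; ring
  rw [setIntegral_congr_fun measurableSet_Ioi fun v _ => hpt v] at key
  have h4 := integral_comp_mul_left_Ioi
    (fun t : ℝ => Complex.exp (-((1 - ζ) / h) * t) * (f t : ℂ)) 0 hh
  rw [mul_zero] at h4
  rw [h4, Complex.real_smul, Complex.ofReal_inv] at key
  rwa [laplaceTransform, div_eq_inv_mul]

theorem laplaceTransform_floor {a : ℕ → ℝ} (ha : ∀ j, |a j| ≤ 1) (hh : 0 < h) {z : ℂ}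
    (hz : 0 < z.re) :
    HasSum (fun j : ℕ => (a j : ℂ) * Complex.exp (-(h * z)) ^ j * ((1 - Complex.exp (-(h * z))) / z))
      (laplaceTransform (fun t => a ⌊t / h⌋₊) z) := by
  have hz0 : z ≠ 0 := fun hz' => by simp [hz'] at hz
  have hmeas : Measurable fun t : ℝ => a ⌊t / h⌋₊ :=
    (measurable_from_nat (f := a)).comp (Nat.measurable_floor.comp (measurable_id.div_const h))
  have hint : IntegrableOn (fun t : ℝ => Complex.exp (-z * t) * (a ⌊t / h⌋₊ : ℂ)) (Ioi 0) := by
    refine Integrable.mono' (integrableOn_exp_mul_Ioi (neg_neg_iff_pos.2 hz) 0)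
      (Measurable.aestronglyMeasurable ?_) (ae_of_all _ fun t => ?_)
    · exact (Continuous.measurable (by fun_prop)).mul (Complex.measurable_ofReal.comp hmeas)
    · rw [norm_mul, norm_cexp_neg_mul_ofReal, Complex.norm_real]
      exact mul_le_of_le_one_right (Real.exp_pos _).le (ha _)
  have hcell : ∀ j : ℕ, ∀ t : ℝ, t ∈ Ico (j * h) ((j + 1) * h) ↔ 0 ≤ t ∧ ⌊t / h⌋₊ = j :=
    fun j t => by
      constructor
      · rintro ⟨h1, h2⟩
        have h0 : 0 ≤ t := le_trans (by positivity) h1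
        exact ⟨h0, (Nat.floor_eq_iff (by positivity)).2
          ⟨(le_div_iff₀ hh).2 h1, (div_lt_iff₀ hh).2 h2⟩⟩
      · rintro ⟨h0, h1⟩
        obtain ⟨h2, h3⟩ := (Nat.floor_eq_iff (by positivity)).1 h1
        exact ⟨(le_div_iff₀ hh).1 h2, (div_lt_iff₀ hh).1 h3⟩
  have hU : ⋃ j : ℕ, Ico ((j : ℝ) * h) ((j + 1) * h) = Ici 0 := by
    ext t
    simp only [mem_iUnion, hcell, mem_Ici]
    exact ⟨fun ⟨_, h1, _⟩ => h1, fun h1 => ⟨_, h1, rfl⟩⟩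
  have hdisj : Pairwise (Function.onFun Disjoint fun j : ℕ => Ico ((j : ℝ) * h) ((j + 1) * h)) := by
    intro i j hij
    refine Set.disjoint_left.2 fun t h1 h2 => hij ?_
    rw [← ((hcell i t).1 h1).2, ((hcell j t).1 h2).2]
  have key := hasSum_integral_iUnion (fun j => measurableSet_Ico) hdisj
    (by rw [hU]; exact (integrableOn_Ici_iff_integrableOn_Ioi (by simp)).2 hint)
  rw [hU, integral_Ici_eq_integral_Ioi] at key
  suffices hterm : ∀ j : ℕ, ∫ t in Ico ((j : ℝ) * h) ((j + 1) * h),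
      Complex.exp (-z * t) * (a ⌊t / h⌋₊ : ℂ) =
      (a j : ℂ) * Complex.exp (-(h * z)) ^ j * ((1 - Complex.exp (-(h * z))) / z) by
    simp_rw [hterm] at key
    exact key
  intro j
  have h1 : ∫ t in Ico ((j : ℝ) * h) ((j + 1) * h), Complex.exp (-z * t) * (a ⌊t / h⌋₊ : ℂ) =
      ∫ t in Ico ((j : ℝ) * h) ((j + 1) * h), Complex.exp (-z * t) * (a j : ℂ) :=
    setIntegral_congr_fun measurableSet_Ico fun t ht => by
      simp only [((hcell j t).1 ht).2]
  rw [h1, integral_mul_const, integral_Ico_eq_integral_Ioc,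
    ← intervalIntegral.integral_of_le (by nlinarith), integral_exp_mul_complex (neg_ne_zero.2 hz0),
    ← Complex.exp_nat_mul]
  have h2 : Complex.exp (-z * ((j : ℝ) * h : ℝ)) = Complex.exp (j * -(h * z)) := by
    congr 1; push_cast; ring
  have h3 : Complex.exp (-z * (((j : ℝ) + 1) * h : ℝ)) =
      Complex.exp (j * -(h * z)) * Complex.exp (-(h * z)) := by
    rw [← Complex.exp_add]; congr 1; push_cast; ring
  rw [h2, h3]
  field_simp
  ring

theorem laplaceTransform_gammaAverage_floor (hf : ContinuousOn f (Ici 0))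
    (hf1 : ∀ t, 0 ≤ t → |f t| ≤ 1) (hh : 0 < h) {z : ℂ} (hz : 0 < z.re) :
    laplaceTransform (fun t => gammaAverage f h ⌊t / h⌋₊) z =
      eulerSymbol h z * laplaceTransform f (eulerSymbol h z) / z := by
  have hζ : ‖Complex.exp (-(h * z))‖ < 1 := by
    rw [Complex.norm_exp, Real.exp_lt_one_iff]
    simpa using mul_pos hh hz
  have h1 := laplaceTransform_floor (abs_gammaAverage_le_one hf1 hh) hh hz
  have h2 := (hasSum_gammaAverage_mul_pow hf hf1 hh hζ).mul_right
    ((1 - Complex.exp (-(h * z))) / z)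
  rw [h1.unique h2, eulerSymbol]
  ring

end GammaAverage

section ModeEstimate

open FourierTransform

theorem lintegral_min_sq_le {a : ℝ} (ha : 0 < a) :
    ∫⁻ ξ : ℝ, ENNReal.ofReal (2 * a ^ 2 * (1 + (a * ξ) ^ 2)⁻¹) =
      ENNReal.ofReal (2 * Real.pi * a) := by
  have hint : Integrable fun ξ : ℝ => 2 * a ^ 2 * (1 + (a * ξ) ^ 2)⁻¹ :=
    (integrable_inv_one_add_sq.comp_mul_left' ha.ne').const_mul _
  rw [← ofReal_integral_eq_lintegral_ofReal hint (ae_of_all _ fun ξ => by positivity),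
    integral_const_mul, Measure.integral_comp_mul_left (fun x => (1 + x ^ 2)⁻¹) a,
    integral_univ_inv_one_add_sq, abs_of_pos (inv_pos.2 ha), smul_eq_mul]
  congr 1; field_simp

theorem min_inv_sq_le {a r ξ : ℝ} (ha : 0 < a) (hr : 0 < r) (hξ : |ξ| ≤ r) :
    (min a r⁻¹) ^ 2 ≤ 2 * a ^ 2 * (1 + (a * ξ) ^ 2)⁻¹ := by
  have h1 : (a * ξ) ^ 2 ≤ (a * r) ^ 2 := by
    rw [mul_pow, mul_pow, ← sq_abs ξ]; gcongr
  rw [← div_eq_mul_inv, le_div_iff₀ (by positivity)]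
  have hm0 : 0 ≤ min a r⁻¹ := le_min ha.le (inv_pos.2 hr).le
  have h2 : min a r⁻¹ * r ≤ 1 := by
    calc _ ≤ r⁻¹ * r := by gcongr; exact min_le_right _ _
      _ = 1 := inv_mul_cancel₀ hr.ne'
  have h3 : (min a r⁻¹ * r) ^ 2 ≤ 1 := pow_le_one₀ (by positivity) h2
  have h4 : (min a r⁻¹) ^ 2 ≤ a ^ 2 := by gcongr; exact min_le_left _ _
  calc (min a r⁻¹) ^ 2 * (1 + (a * ξ) ^ 2) ≤ (min a r⁻¹) ^ 2 * (1 + (a * r) ^ 2) := by gcongr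
    _ = (min a r⁻¹) ^ 2 + a ^ 2 * (min a r⁻¹ * r) ^ 2 := by ring
    _ ≤ a ^ 2 + a ^ 2 * 1 := by gcongr
    _ = _ := by ring

/-- The `L²` error between the scalar resolvent and its piecewise constant quadrature
approximation is of order `min h (λ ^ (-1 / ρ))`, uniformly in `λ`. -/
theorem Assumption1.exists_lintegral_sub_gammaAverage_le {b b' : ℝ → ℝ} {ρ θ T : ℝ}
    (hb : Assumption1 b b' ρ) (hb2 : Assumption2 b ρ θ) (hT : 0 < T) :
    ∃ K > 0, ∀ lam > 0, ∀ s s' : ℝ → ℝ, IsScalarSolution b lam s s' → ∀ h > 0, h ≤ T →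
      ∫⁻ t in Ioc 0 T, ENNReal.ofReal ((s t - gammaAverage s h ⌊t / h⌋₊) ^ 2) ≤
        ENNReal.ofReal (K * min h (lam ^ (-(1 / ρ)))) := by
  obtain ⟨B, κ, c, C, hB, hBb⟩ := hb.exists_isSectorialSymbol hb2 (x₀ := (1 + T)⁻¹) (by positivity)
  obtain ⟨M, hM, hest⟩ := hB.exists_norm_resolventSymbol_sub_le hT
  refine ⟨Real.exp (2 * T) * (M ^ 2 * (2 * Real.pi)), by positivity, ?_⟩
  intro lam hlam s s' hs h hh hhT
  set a : ℝ := min h (lam ^ (-(1 / ρ))) with ha_def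
  have ha : 0 < a := lt_min hh (Real.rpow_pos_of_pos hlam _)
  have hs1 : ∀ t, 0 ≤ t → |s t| ≤ 1 := fun t ht => hs.abs_le_one hb hlam ht
  set β : ℝ → ℝ := fun t => gammaAverage s h ⌊t / h⌋₊ with hβ_def
  have hβ1 : ∀ t, |β t| ≤ 1 := fun t => abs_gammaAverage_le_one hs1 hh _
  have hβmeas : Measurable β :=
    (measurable_from_nat (f := gammaAverage s h)).comp
      (Nat.measurable_floor.comp (measurable_id.div_const h))
  have hβint : ∀ z : ℂ, 0 < z.re →
      IntegrableOn (fun t : ℝ => Complex.exp (-z * t) * (β t : ℂ)) (Ioi 0) := fun z hz => by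
    refine Integrable.mono' (integrableOn_exp_mul_Ioi (neg_neg_iff_pos.2 hz) 0)
      ((Continuous.measurable (by fun_prop)).mul
        (Complex.measurable_ofReal.comp hβmeas)).aestronglyMeasurable (ae_of_all _ fun t => ?_)
    rw [norm_mul, norm_cexp_neg_mul_ofReal, Complex.norm_real]
    exact mul_le_of_le_one_right (Real.exp_pos _).le (hβ1 t)
  have hsplit : ∀ z : ℂ, ∀ t : ℝ, Complex.exp (-z * t) * ((s t - β t : ℝ) : ℂ) =
      Complex.exp (-z * t) * (s t : ℂ) - Complex.exp (-z * t) * (β t : ℂ) := fun z t => by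
    push_cast; ring
  set F : ℝ → ℂ := indicator (Ioi 0)
    fun t : ℝ => Complex.exp (-((1 : ℝ) : ℂ) * t) * ((s t - β t : ℝ) : ℂ) with hF_def
  have hFint : Integrable F := by
    rw [hF_def, integrable_indicator_iff measurableSet_Ioi]
    simp_rw [hsplit]
    exact (hs.integrableOn_exp_mul hb hlam (by simp)).sub (hβint _ (by simp))
  have hFbd : ∀ t, ‖F t‖ ≤ 2 := fun t => by
    by_cases ht : t ∈ Ioi (0 : ℝ)
    · rw [hF_def, indicator_of_mem ht, norm_mul, norm_cexp_neg_mul_ofReal, Complex.norm_real]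
      have h1 : Real.exp (-(((1 : ℝ) : ℂ)).re * t) ≤ 1 := by
        have : (0 : ℝ) < t := ht
        simpa using this.le
      have h2 : ‖s t - β t‖ ≤ 2 := by
        refine (norm_sub_le _ _).trans ?_
        have := hs1 t (le_of_lt ht); have := hβ1 t
        rw [Real.norm_eq_abs, Real.norm_eq_abs]; linarith
      calc _ ≤ 1 * (2 : ℝ) := mul_le_mul h1 h2 (norm_nonneg _) zero_le_one
        _ = 2 := one_mul _
    · rw [hF_def, indicator_of_notMem ht]; simp
  have hlap : ∀ z : ℂ, 0 < z.re → z * laplaceTransform s z = resolventSymbol B lam z :=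
    fun z hz => by
      have h1 := hs.mul_laplaceTransform hb hlam hz
      rw [← hBb z hz] at h1
      rw [resolventSymbol, eq_div_iff (left_ne_zero_of_mul_eq_one h1)]
      linear_combination z * h1
  have hFour : ∀ ξ : ℝ, ‖𝓕 F ξ‖ ^ 2 ≤ M ^ 2 * (2 * a ^ 2 * (1 + (a * ξ) ^ 2)⁻¹) := fun ξ => by
    set z : ℂ := ((1 : ℝ) : ℂ) + (2 * Real.pi * ξ : ℝ) * Complex.I with hz_def
    have hzre : z.re = 1 := by simp [hz_def]
    have hzim : z.im = 2 * Real.pi * ξ := by simp [hz_def]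
    have hz0 : z ≠ 0 := fun h0 => by simp [h0] at hzre
    have hψ : 0 < (eulerSymbol h z).re :=
      lt_of_lt_of_le (by positivity) (le_re_eulerSymbol hh hhT hzre)
    have h1 : 𝓕 F ξ = (resolventSymbol B lam z - resolventSymbol B lam (eulerSymbol h z)) / z := by
      rw [hF_def, fourier_indicator_exp_mul (fun t => ((s t - β t : ℝ) : ℂ)), ← hz_def]
      simp_rw [hsplit]
      rw [integral_sub (hs.integrableOn_exp_mul hb hlam (by simp [hzre]))
        (hβint _ (by simp [hzre]))]
      change laplaceTransform s z - laplaceTransform β z = _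
      rw [laplaceTransform_gammaAverage_floor hs.cont hs1 hh (by simp [hzre]), hlap _ hψ, sub_div,
        ← hlap z (by simp [hzre]), mul_div_cancel_left₀ _ hz0]
    have h2 := hest lam hlam h hh hhT z hzre
    rw [← h1] at h2
    have h3 : |ξ| ≤ ‖z‖ := by
      refine le_trans ?_ (Complex.abs_im_le_norm z)
      rw [hzim, abs_mul, abs_of_pos (by positivity : (0 : ℝ) < 2 * Real.pi)]
      nlinarith [abs_nonneg ξ, Real.pi_gt_three]
    calc ‖𝓕 F ξ‖ ^ 2 ≤ (M * min a ‖z‖⁻¹) ^ 2 := by gcongr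
      _ = M ^ 2 * (min a ‖z‖⁻¹) ^ 2 := mul_pow _ _ _
      _ ≤ _ := by
        gcongr
        exact min_inv_sq_le ha (norm_pos_iff.2 hz0) h3
  have hPl : ∫⁻ t, ‖F t‖ₑ ^ 2 ≤ ENNReal.ofReal (M ^ 2 * (2 * Real.pi * a)) := by
    rw [← lintegral_enorm_sq_fourier hFint (memLp_two_of_integrable_of_bound hFint hFbd),
      ENNReal.ofReal_mul (by positivity), ← lintegral_min_sq_le ha,
      ← lintegral_const_mul' _ _ ENNReal.ofReal_ne_top]
    refine lintegral_mono fun ξ => ?_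
    rw [← ofReal_norm, ← ENNReal.ofReal_pow (norm_nonneg _), ← ENNReal.ofReal_mul (by positivity)]
    exact ENNReal.ofReal_le_ofReal (hFour ξ)
  calc ∫⁻ t in Ioc 0 T, ENNReal.ofReal ((s t - β t) ^ 2)
      ≤ ∫⁻ t in Ioc 0 T, ENNReal.ofReal (Real.exp (2 * T)) * ‖F t‖ₑ ^ 2 := by
        refine setLIntegral_mono' measurableSet_Ioc fun t ht => ?_
        rw [← ofReal_norm, ← ENNReal.ofReal_pow (norm_nonneg _),
          ← ENNReal.ofReal_mul (by positivity), hF_def,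
          indicator_of_mem (show t ∈ Ioi 0 from ht.1), norm_mul, norm_cexp_neg_mul_ofReal,
          Complex.norm_real, mul_pow, Real.norm_eq_abs, sq_abs, ← mul_assoc, sq (Real.exp _),
          ← Real.exp_add, ← Real.exp_add]
        refine ENNReal.ofReal_le_ofReal (le_mul_of_one_le_left (sq_nonneg _) ?_)
        refine Real.one_le_exp ?_
        have := ht.2
        simp; linarith
    _ ≤ ENNReal.ofReal (Real.exp (2 * T)) * ∫⁻ t, ‖F t‖ₑ ^ 2 := by
        rw [lintegral_const_mul' _ _ ENNReal.ofReal_ne_top]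
        gcongr
        exact Measure.restrict_le_self
    _ ≤ ENNReal.ofReal (Real.exp (2 * T)) * ENNReal.ofReal (M ^ 2 * (2 * Real.pi * a)) := by
        gcongr
    _ = _ := by
        rw [← ENNReal.ofReal_mul (by positivity)]; congr 1; ring

end ModeEstimate

section HilbertBasisExpansion

variable {H : Type*} [NormedAddCommGroup H] [InnerProductSpace ℝ H] (e : HilbertBasis ℕ ℝ H)

theorem HilbertBasis.hasSum_sq_inner (x : H) : HasSum (fun k => ⟪x, e k⟫ ^ 2) (‖x‖ ^ 2) := by
  have h := e.hasSum_inner_mul_inner x x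
  rw [real_inner_self_eq_norm_sq] at h
  simpa only [real_inner_comm, sq] using h

theorem HilbertBasis.ofReal_norm_sq_eq_tsum (x : H) :
    ENNReal.ofReal (‖x‖ ^ 2) = ∑' k, ENNReal.ofReal (⟪x, e k⟫ ^ 2) := by
  have h := e.hasSum_sq_inner x
  rw [← h.tsum_eq, ENNReal.ofReal_tsum_of_nonneg (fun k => sq_nonneg _) h.summable]

variable {s : ℕ → ℝ → ℝ} {t : ℝ}

theorem hasSum_Sop (hs : ∀ k, |s k t| ≤ 1) (x : H) :
    HasSum (fun k => (s k t * ⟪x, e k⟫) • (e k : H)) (Sop e s t x) ∧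
      ∀ k, ⟪Sop e s t x, e k⟫ = s k t * ⟪x, e k⟫ := by
  have hmem : Memℓp (fun k => s k t * ⟪x, e k⟫) 2 := by
    refine memℓp_gen ?_
    simp only [ENNReal.toReal_ofNat, Real.rpow_ofNat]
    refine Summable.of_nonneg_of_le (fun k => by positivity) (fun k => ?_)
      (e.hasSum_sq_inner x).summable
    rw [Real.norm_eq_abs, sq_abs, mul_pow]
    exact mul_le_of_le_one_left (sq_nonneg _) ((sq_le_one_iff_abs_le_one _).2 (hs k))
  have h : HasSum (fun k => (s k t * ⟪x, e k⟫) • (e k : H)) (e.repr.symm ⟨_, hmem⟩) :=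
    e.hasSum_repr_symm ⟨_, hmem⟩
  refine ⟨h.summable.hasSum, fun k => ?_⟩
  rw [Sop, h.tsum_eq, real_inner_comm, ← e.repr_apply_apply, LinearIsometryEquiv.apply_symm_apply]

theorem norm_Sop_le (hs : ∀ k, |s k t| ≤ 1) (x : H) : ‖Sop e s t x‖ ≤ ‖x‖ := by
  refine (sq_le_sq₀ (norm_nonneg _) (norm_nonneg _)).1 ?_
  refine hasSum_le (fun k => ?_) (e.hasSum_sq_inner _) (e.hasSum_sq_inner x)
  rw [(hasSum_Sop e hs x).2 k, mul_pow]
  exact mul_le_of_le_one_left (sq_nonneg _) ((sq_le_one_iff_abs_le_one _).2 (hs k))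

theorem inner_quadB_Sop [CompleteSpace H] (hs : ∀ k t, 0 ≤ t → |s k t| ≤ 1)
    (hsc : ∀ k, ContinuousOn (s k) (Ici 0)) {h : ℝ} (hh : 0 < h) (x : H) (j k : ℕ) :
    ⟪quadB h (fun r => Sop e s r x) (j + 1), e k⟫ = gammaAverage (s k) h j * ⟪x, e k⟫ := by
  have hmaps : MapsTo (fun v : ℝ => h * v) (Ioi 0) (Ici 0) := fun v hv => (mul_pos hh hv).le
  have hmeas : AEStronglyMeasurable (fun v => Sop e s (h * v) x) (volume.restrict (Ioi 0)) := by
    refine aestronglyMeasurable_of_tendsto_ae atTop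
      (f := fun N v => ∑ k ∈ Finset.range N, (s k (h * v) * ⟪x, e k⟫) • (e k : H)) (fun N => ?_) ?_
    · refine ContinuousOn.aestronglyMeasurable ?_ measurableSet_Ioi
      refine continuousOn_finsetSum _ fun k _ => ?_
      exact (((hsc k).comp (Continuous.continuousOn (by fun_prop)) hmaps).mul
        continuousOn_const).smul continuousOn_const
    · filter_upwards [ae_restrict_mem measurableSet_Ioi] with v hv
      exact (hasSum_Sop e (fun k => hs k _ (hmaps hv)) x).1.tendsto_sum_nat
  have hint : IntegrableOn (fun v => gammaWeight j v • Sop e s (h * v) x) (Ioi 0) := by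
    refine Integrable.mono' ((integrableOn_gammaWeight j).mul_const ‖x‖)
      ((integrableOn_gammaWeight j).1.smul hmeas) ?_
    filter_upwards [ae_restrict_mem measurableSet_Ioi] with v hv
    rw [norm_smul, Real.norm_eq_abs, abs_of_nonneg (gammaWeight_nonneg j (le_of_lt hv))]
    exact mul_le_mul_of_nonneg_left (norm_Sop_le e (fun k => hs k _ (hmaps hv)) x)
      (gammaWeight_nonneg j (le_of_lt hv))
  rw [real_inner_comm]
  refine (integral_inner hint (e k)).symm.trans ?_
  rw [gammaAverage, ← integral_mul_const]
  refine setIntegral_congr_fun measurableSet_Ioi fun v hv => ?_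
  rw [real_inner_smul_right, real_inner_comm, (hasSum_Sop e (fun k => hs k _ (hmaps hv)) x).2 k,
    mul_assoc]

end HilbertBasisExpansion

section Assembly

theorem sum_setLIntegral_Ioc (φ : ℝ → ℝ≥0∞) {h : ℝ} (hh : 0 ≤ h) (n : ℕ) :
    ∑ k ∈ Finset.Icc 1 n, ∫⁻ u in Ioc (((k : ℝ) - 1) * h) (k * h), φ u =
      ∫⁻ u in Ioc 0 (n * h), φ u := by
  induction n with
  | zero => simp
  | succ n ih =>
    rw [Finset.sum_Icc_succ_top (by omega), ih, ← lintegral_union measurableSet_Ioc]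
    · push_cast
      rw [add_sub_cancel_right, Ioc_union_Ioc_eq_Ioc (by positivity) (by nlinarith)]
    · push_cast
      rw [add_sub_cancel_right]
      exact Ioc_disjoint_Ioc_of_le le_rfl

theorem setLIntegral_Ioc_comp_sub (g : ℝ → ℝ≥0∞) (T : ℝ) :
    ∫⁻ u in Ioc 0 T, g (T - u) = ∫⁻ t in Ioc 0 T, g t := by
  rw [setLIntegral_congr (Ico_ae_eq_Ioc (a := (0 : ℝ)) (b := T)).symm,
    ← lintegral_indicator measurableSet_Ico (f := fun u => g (T - u)),
    ← lintegral_indicator measurableSet_Ioc, 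
    ← lintegral_sub_left_eq_self ((Ioc 0 T).indicator g) T]
  congr 1; ext u
  have : T - u ∈ Ioc 0 T ↔ u ∈ Ico 0 T := by
    simp only [mem_Ioc, mem_Ico]
    constructor <;> rintro ⟨h1, h2⟩ <;> constructor <;> linarith
  by_cases hu : u ∈ Ico 0 T
  · rw [indicator_of_mem hu, indicator_of_mem (this.2 hu)]
  · rw [indicator_of_notMem hu, indicator_of_notMem (fun h => hu (this.1 h))]

theorem min_rpow_le {h lam ρ σ γ T : ℝ} (hρ : 0 < ρ) (hh : 0 < h) (hhT : h ≤ T) (hlam : 0 < lam)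
    (hσ0 : 0 < σ) (hσ1 : σ ≤ 1 / ρ) (hγ : γ < ρ * σ / 2) :
    min h (lam ^ (-(1 / ρ))) ≤ T ^ (ρ * σ - 2 * γ) * h ^ (2 * γ) * lam ^ (σ - 1 / ρ) := by
  have hL : 0 < lam ^ (-(1 / ρ)) := Real.rpow_pos_of_pos hlam _
  have hm : 0 < min h (lam ^ (-(1 / ρ))) := lt_min hh hL
  have hρσ : ρ * σ ≤ 1 := by
    have := mul_le_mul_of_nonneg_left hσ1 hρ.le
    rwa [mul_one_div_cancel hρ.ne'] at this
  calc min h (lam ^ (-(1 / ρ)))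
      = min h (lam ^ (-(1 / ρ))) ^ (ρ * σ) * min h (lam ^ (-(1 / ρ))) ^ (1 - ρ * σ) := by
        rw [← Real.rpow_add hm]; simp
    _ ≤ h ^ (ρ * σ) * (lam ^ (-(1 / ρ))) ^ (1 - ρ * σ) := by
        gcongr
        · exact min_le_left _ _
        · exact min_le_right _ _
    _ = h ^ (ρ * σ - 2 * γ) * h ^ (2 * γ) * lam ^ (σ - 1 / ρ) := by
        rw [← Real.rpow_mul hlam.le, ← Real.rpow_add hh]
        congr 2
        · ring
        · field_simp; ring
    _ ≤ _ := by
        gcongr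
        linarith

theorem floor_sub_div_eq {T h u : ℝ} {n k : ℕ} (hh : 0 < h) (hnh : n * h = T) (hkn : k ≤ n)
    (hu : u ∈ Ioc (((k : ℝ) - 1) * h) (k * h)) : ⌊(T - u) / h⌋₊ = n - k := by
  have hkn' : (k : ℝ) ≤ n := by exact_mod_cast hkn
  rw [Nat.floor_eq_iff (div_nonneg (by nlinarith [hu.2]) hh.le), le_div_iff₀ hh, div_lt_iff₀ hh,
    Nat.cast_sub hkn]
  constructor <;> nlinarith [hu.1, hu.2]

variable {H : Type*} [NormedAddCommGroup H] [InnerProductSpace ℝ H] [CompleteSpace H]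
  (e : HilbertBasis ℕ ℝ H) {s : ℕ → ℝ → ℝ}

theorem sum_setLIntegral_norm_sub_eq (hs : ∀ k t, 0 ≤ t → |s k t| ≤ 1)
    (hsc : ∀ k, ContinuousOn (s k) (Ici 0)) {h T : ℝ} (hh : 0 < h) {n : ℕ} (hnh : n * h = T)
    (x : H) :
    ∑ k ∈ Finset.Icc 1 n, ∫⁻ u in Ioc (((k : ℝ) - 1) * h) (k * h),
        ENNReal.ofReal (‖Sop e s (T - u) x - quadB h (fun r => Sop e s r x) (n - k + 1)‖ ^ 2) =
      ∑' j, ENNReal.ofReal (⟪x, e j⟫ ^ 2) *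
        ∫⁻ t in Ioc 0 T, ENNReal.ofReal ((s j t - gammaAverage (s j) h ⌊t / h⌋₊) ^ 2) := by
  have hcell : ∀ k ∈ Finset.Icc 1 n, ∀ u ∈ Ioc (((k : ℝ) - 1) * h) (k * h),
      ENNReal.ofReal (‖Sop e s (T - u) x - quadB h (fun r => Sop e s r x) (n - k + 1)‖ ^ 2) =
        ∑' j, ENNReal.ofReal (⟪x, e j⟫ ^ 2) * ENNReal.ofReal
          ((s j (T - u) - gammaAverage (s j) h ⌊(T - u) / h⌋₊) ^ 2) := fun k hk u hu => by
    have hkn := (Finset.mem_Icc.1 hk).2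
    have hkn' : (k : ℝ) ≤ n := by exact_mod_cast hkn
    have hTu : 0 ≤ T - u := by nlinarith [hu.2]
    rw [e.ofReal_norm_sq_eq_tsum]
    refine tsum_congr fun j => ?_
    rw [inner_sub_left, (hasSum_Sop e (fun k => hs k _ hTu) x).2 j,
      inner_quadB_Sop e hs hsc hh, floor_sub_div_eq hh hnh hkn hu, ← sub_mul, mul_pow, mul_comm,
      ENNReal.ofReal_mul (sq_nonneg _)]
  rw [Finset.sum_congr rfl fun k hk => setLIntegral_congr_fun measurableSet_Ioc (hcell k hk),
    sum_setLIntegral_Ioc _ hh.le, hnh, setLIntegral_Ioc_comp_sub fun t =>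
      ∑' j, ENNReal.ofReal (⟪x, e j⟫ ^ 2) * ENNReal.ofReal
        ((s j t - gammaAverage (s j) h ⌊t / h⌋₊) ^ 2), lintegral_tsum]
  · exact tsum_congr fun j => lintegral_const_mul' _ _ ENNReal.ofReal_ne_top
  · refine fun j => AEMeasurable.const_mul (AEMeasurable.ennreal_ofReal (AEMeasurable.pow_const
      (AEMeasurable.sub ?_ (Measurable.aemeasurable ?_)) 2)) _
    · exact ((hsc j).mono fun t ht => ht.1.le).aemeasurable measurableSet_Ioc
    · exact (measurable_from_nat (f := gammaAverage (s j) h)).comp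
        (Nat.measurable_floor.comp (measurable_id.div_const h))

theorem sum_setLIntegral_norm_sub_le (hs : ∀ k t, 0 ≤ t → |s k t| ≤ 1)
    (hsc : ∀ k, ContinuousOn (s k) (Ici 0)) {h T C : ℝ} {w : ℕ → ℝ} (hC : 0 ≤ C) (hh : 0 < h)
    {n : ℕ} (hnh : n * h = T) (x : H)
    (hmode : ∀ j, ∫⁻ t in Ioc 0 T,
      ENNReal.ofReal ((s j t - gammaAverage (s j) h ⌊t / h⌋₊) ^ 2) ≤ ENNReal.ofReal (C * w j)) :
    ∑ k ∈ Finset.Icc 1 n, ∫⁻ u in Ioc (((k : ℝ) - 1) * h) (k * h),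
        ENNReal.ofReal (‖Sop e s (T - u) x - quadB h (fun r => Sop e s r x) (n - k + 1)‖ ^ 2) ≤
      ENNReal.ofReal C * ∑' j, ENNReal.ofReal (w j * ⟪x, e j⟫ ^ 2) := by
  rw [sum_setLIntegral_norm_sub_eq e hs hsc hh hnh x, ← ENNReal.tsum_mul_left]
  refine ENNReal.tsum_le_tsum fun j => ?_
  grw [hmode j]
  rw [← ENNReal.ofReal_mul (sq_nonneg _), ← ENNReal.ofReal_mul hC]
  exact (congrArg ENNReal.ofReal (by ring)).le

end Assembly

/-- the noise contribution to the strong error of the time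
discretization:
`Σ_i Σ_{k=1}^n ∫_{t_{k-1}}^{t_k} ‖(S(t_n-u) - B_{n-k+1}) Q^{1/2} e_i‖² du
  ≤ K Δt^{2γ} Σ_i Σ_j λ_j^{σ-1/ρ} (Q^{1/2}e_i,e_j)²`
for `0 < σ ≤ 1/ρ`, `γ < ρσ/2`, `Δt = T/n`, `t_n = T`. -/
theorem statement19 {H : Type*} [NormedAddCommGroup H] [InnerProductSpace ℝ H]
    [CompleteSpace H]
    (b b' : ℝ → ℝ) (ρ θ : ℝ) (hb : Assumption1 b b' ρ) (hb2 : Assumption2 b ρ θ)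
    (e : HilbertBasis ℕ ℝ H) (lam : ℕ → ℝ)
    (hlam_pos : ∀ k, 0 < lam k) (hlam_mono : Monotone lam)
    (hlam_top : Tendsto lam atTop atTop)
    (s s' : ℕ → ℝ → ℝ) (hs : ∀ k, IsScalarSolution b (lam k) (s k) (s' k))
    (Q Qhalf : H →L[ℝ] H)
    (hQ_sa : ∀ x y : H, ⟪Q x, y⟫ = ⟪x, Q y⟫) (hQ_nonneg : ∀ x : H, 0 ≤ ⟪Q x, x⟫)
    (hQhalf_sa : ∀ x y : H, ⟪Qhalf x, y⟫ = ⟪x, Qhalf y⟫)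
    (hQhalf_nonneg : ∀ x : H, 0 ≤ ⟪Qhalf x, x⟫)
    (hQhalf_sq : ∀ x : H, Qhalf (Qhalf x) = Q x)
    (T σ γ : ℝ) (hT : 0 < T) (hσ0 : 0 < σ) (hσ1 : σ ≤ 1 / ρ) (hγ : γ < ρ * σ / 2) :
    ∃ K > 0, ∀ n : ℕ, 1 ≤ n →
      (∑' i, ∑ k ∈ Finset.Icc 1 n,
          ∫⁻ u in Set.Ioc (((k : ℝ) - 1) * (T / (n : ℝ))) ((k : ℝ) * (T / (n : ℝ))),
            ENNReal.ofReal
              (‖Sop e s (T - u) (Qhalf (e i)) -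
                  quadB (T / (n : ℝ)) (fun r => Sop e s r (Qhalf (e i)))
                    (n - k + 1)‖ ^ 2)) ≤
        ENNReal.ofReal (K * (T / (n : ℝ)) ^ (2 * γ)) *
          ∑' i, ∑' j, ENNReal.ofReal (lam j ^ (σ - 1 / ρ) * ⟪Qhalf (e i), e j⟫ ^ 2) := by

  have hρ : 0 < ρ := by linarith [hb.rho_mem.1]
  obtain ⟨K, hK, hmode⟩ := hb.exists_lintegral_sub_gammaAverage_le hb2 hT
  refine ⟨K * T ^ (ρ * σ - 2 * γ), by positivity, fun n hn => ?_⟩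
  have hn0 : (0 : ℝ) < n := by exact_mod_cast hn
  set h := T / (n : ℝ) with hh_def
  have hh : 0 < h := div_pos hT hn0
  have hhT : h ≤ T := div_le_self hT.le (by exact_mod_cast hn)
  have hnh : n * h = T := by rw [hh_def]; field_simp
  rw [← ENNReal.tsum_mul_left]
  refine ENNReal.tsum_le_tsum fun i => ?_
  exact sum_setLIntegral_norm_sub_le e (fun k t ht => (hs k).abs_le_one hb (hlam_pos k) ht)
    (fun k => (hs k).cont) (by positivity) hh hnh _ fun k => (hmode _ (hlam_pos k) _ _ (hs k) h hh hhT).trans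
      (ENNReal.ofReal_le_ofReal (by
        rw [mul_assoc K, mul_assoc K]
        exact mul_le_mul_of_nonneg_left
          (min_rpow_le hρ hh hhT (hlam_pos k) hσ0 hσ1 hγ) hK.le))
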